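/- arXiv:2106.06120 — 2 statements merged into one kernel-verified Lean document; each statement's English description precedes it below -/
import Mathlib

section
/- Let n ≥ 1 and p > n. There exists a constant C = C(n, p) > 0 such that for every function ũ that is continuously differentiable on the set {x ∈ ℝ^{n+1} : |x| ≤ 1, x_{n+1} ≥ 0} and harmonic on its interior {x ∈ ℝ^{n+1} : |x| < 1, x_{n+1} > 0}, one has ‖ũ‖_{L^∞(B⁺_{1/4})} ≤ C (‖ũ‖_{L²(B⁺₁)} + ‖g‖_{Lᵖ(B'₁)}), where g(x') := ∂_{n+1}ũ(x', 0). -/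
open MeasureTheory

/-- The (coordinate-wise) Laplacian of `f : ℝ^m → ℝ` at `x`:
`∑ i, ∂²f/∂xᵢ²` computed via iterated Fréchet derivatives in coordinate directions. -/
noncomputable def lapl {m : ℕ} (f : EuclideanSpace ℝ (Fin m) → ℝ)
    (x : EuclideanSpace ℝ (Fin m)) : ℝ :=
  ∑ i : Fin m, fderiv ℝ (fun y => fderiv ℝ f y (EuclideanSpace.single i 1)) x
    (EuclideanSpace.single i 1)

/-- `f` is harmonic on the (open) set `U`: it is `C²` on `U` and its Laplacian vanishes on `U`. -/
def HarmonicOnSet {m : ℕ} (f : EuclideanSpace ℝ (Fin m) → ℝ)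
    (U : Set (EuclideanSpace ℝ (Fin m))) : Prop :=
  ContDiffOn ℝ 2 f U ∧ ∀ x ∈ U, lapl f x = 0

/-- The south pole `s = (0, …, 0, -1)` of the unit sphere in `ℝ^{n+1}`. -/
noncomputable def southPole (n : ℕ) : EuclideanSpace ℝ (Fin (n+1)) :=
  -(EuclideanSpace.single (Fin.last n) 1)

/-- The map `Φ(z) = 2 (z - s)/‖z - s‖² + s`. -/
noncomputable def Phi {n : ℕ} (z : EuclideanSpace ℝ (Fin (n+1))) :
    EuclideanSpace ℝ (Fin (n+1)) :=
  (2 / ‖z - southPole n‖ ^ 2) • (z - southPole n) + southPole n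

/-- The Kelvin transform `K[w](z) = 2^{(n-1)/2} ‖z - s‖^{1-n} w(Φ(z))`. -/
noncomputable def kelvin {n : ℕ} (w : EuclideanSpace ℝ (Fin (n+1)) → ℝ)
    (z : EuclideanSpace ℝ (Fin (n+1))) : ℝ :=
  2 ^ (((n : ℝ) - 1) / 2) * ‖z - southPole n‖ ^ ((1 : ℝ) - n) * w (Phi z)

/-- Embed `ℝⁿ` into `ℝ^{n+1}` as the hyperplane `x_{n+1} = 0`. -/
noncomputable def emb {n : ℕ} (x' : EuclideanSpace ℝ (Fin n)) :
    EuclideanSpace ℝ (Fin (n+1)) :=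
  (WithLp.equiv 2 (Fin (n+1) → ℝ)).symm
    (Fin.snoc ((WithLp.equiv 2 (Fin n → ℝ)) x') 0)

/-- The point `(x', t) ∈ ℝ^{n+1}` for `x' ∈ ℝⁿ` and `t ∈ ℝ`. -/
noncomputable def embt {n : ℕ} (x' : EuclideanSpace ℝ (Fin n)) (t : ℝ) :
    EuclideanSpace ℝ (Fin (n+1)) :=
  (WithLp.equiv 2 (Fin (n+1) → ℝ)).symm
    (Fin.snoc ((WithLp.equiv 2 (Fin n → ℝ)) x') t)

/-- The `Lᵖ` norm `(∫_S |f|ᵖ)^{1/p}` of `f` over a set `S` (w.r.t. Lebesgue measure). -/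
noncomputable def LpnormOn {m : ℕ} (f : EuclideanSpace ℝ (Fin m) → ℝ) (p : ℝ)
    (S : Set (EuclideanSpace ℝ (Fin m))) : ℝ :=
  (∫⁻ x in S, ENNReal.ofReal (|f x| ^ p)).toReal ^ (1 / p)

/-- The half ball `B⁺_R(x₀) = {x ∈ ℝ^{n+1} : x_{n+1} > 0, |x - x₀| ≤ R}`. -/
def Bplus {n : ℕ} (x0 : EuclideanSpace ℝ (Fin (n+1))) (R : ℝ) :
    Set (EuclideanSpace ℝ (Fin (n+1))) :=
  {x | 0 < x (Fin.last n) ∧ dist x x0 ≤ R}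

/-- The boundary ball `B'_R(x₀) = {x' ∈ ℝⁿ : |(x', 0) - x₀| ≤ R}`. -/
def Bprime {n : ℕ} (x0 : EuclideanSpace ℝ (Fin (n+1))) (R : ℝ) :
    Set (EuclideanSpace ℝ (Fin n)) :=
  {x' | dist (emb x') x0 ≤ R}

/-- The closed unit half-ball. -/
def closedHalfBall (n : ℕ) : Set (EuclideanSpace ℝ (Fin (n+1))) :=
  {x | ‖x‖ ≤ 1 ∧ 0 ≤ x (Fin.last n)}

theorem emb_last {n : ℕ} (x' : EuclideanSpace ℝ (Fin n)) : emb x' (Fin.last n) = 0 := by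
  simp [emb]

theorem emb_castSucc {n : ℕ} (x' : EuclideanSpace ℝ (Fin n)) (i : Fin n) :
    emb x' i.castSucc = x' i := by
  simp [emb]

theorem norm_emb {n : ℕ} (x' : EuclideanSpace ℝ (Fin n)) : ‖emb x'‖ = ‖x'‖ := by
  simp [EuclideanSpace.norm_eq, Fin.sum_univ_castSucc, emb_last, emb_castSucc]

theorem emb_sub_emb {n : ℕ} (x' y' : EuclideanSpace ℝ (Fin n)) :
    emb x' - emb y' = emb (x' - y') := by
  ext i
  refine Fin.lastCases ?_ (fun j => ?_) i <;> simp [emb_last, emb_castSucc]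

theorem continuous_emb (n : ℕ) : Continuous (emb (n := n)) := by
  refine Isometry.continuous (Isometry.of_dist_eq fun x y => ?_)
  rw [dist_eq_norm, dist_eq_norm, emb_sub_emb, norm_emb]

theorem Bprime_zero (n : ℕ) (r : ℝ) :
    Bprime (n := n) 0 r = Metric.closedBall 0 r := by
  ext x'
  simp [Bprime, norm_emb]

theorem mem_Bplus_zero {n : ℕ} {r : ℝ} {x : EuclideanSpace ℝ (Fin (n+1))} :
    x ∈ Bplus 0 r ↔ 0 < x (Fin.last n) ∧ ‖x‖ ≤ r := by
  simp [Bplus]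

theorem Bplus_subset_closedHalfBall (n : ℕ) : Bplus 0 1 ⊆ closedHalfBall n := fun x hx => by
  rw [mem_Bplus_zero] at hx
  exact ⟨hx.2, hx.1.le⟩

theorem continuous_last (n : ℕ) :
    Continuous fun x : EuclideanSpace ℝ (Fin (n+1)) => x (Fin.last n) := by
  fun_prop

theorem measurableSet_Bplus (n : ℕ) (r : ℝ) :
    MeasurableSet (Bplus (n := n) 0 r) := by
  have : Bplus (n := n) 0 r = {x | 0 < x (Fin.last n)} ∩ Metric.closedBall 0 r := by
    ext x; simp [Bplus]
  rw [this]
  exact (isOpen_lt continuous_const (continuous_last n)).measurableSet.inter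
    Metric.isClosed_closedBall.measurableSet

theorem isCompact_closedHalfBall (n : ℕ) : IsCompact (closedHalfBall n) := by
  have : closedHalfBall n = Metric.closedBall 0 1 ∩ {x | 0 ≤ x (Fin.last n)} := by
    ext x; simp [closedHalfBall]
  rw [this]
  exact (isCompact_closedBall _ _).inter_right (isClosed_le continuous_const (continuous_last n))

theorem isOpen_openHalfBall (n : ℕ) :
    IsOpen {x : EuclideanSpace ℝ (Fin (n+1)) | ‖x‖ < 1 ∧ 0 < x (Fin.last n)} :=
  (isOpen_lt continuous_norm continuous_const).inter
    (isOpen_lt continuous_const (continuous_last n))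

theorem openHalfBall_subset (n : ℕ) :
    {x : EuclideanSpace ℝ (Fin (n+1)) | ‖x‖ < 1 ∧ 0 < x (Fin.last n)} ⊆ closedHalfBall n :=
  fun _ hx => ⟨hx.1.le, hx.2.le⟩

theorem uniqueDiffOn_closedHalfBall (n : ℕ) : UniqueDiffOn ℝ (closedHalfBall n) := by
  refine uniqueDiffOn_convex ?_ ⟨EuclideanSpace.single (Fin.last n) (1/2), ?_⟩
  · have : closedHalfBall n = Metric.closedBall 0 1 ∩ {x | 0 ≤ x (Fin.last n)} := by
      ext x; simp [closedHalfBall]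
    rw [this]
    refine (convex_closedBall _ _).inter ?_
    exact convex_halfSpace_ge (f := fun x : EuclideanSpace ℝ (Fin (n+1)) => x (Fin.last n))
      ⟨fun _ _ => rfl, fun _ _ => rfl⟩ 0
  · refine interior_maximal (openHalfBall_subset n) (isOpen_openHalfBall n) ⟨?_, ?_⟩
    · simp; norm_num
    · simp

/-- A function on the closed half-ball vanishing near the spherical part of the boundary is
continuous on the closed half-space. -/
theorem ContinuousOn.halfSpace_of_vanish {n : ℕ} {f : EuclideanSpace ℝ (Fin (n+1)) → ℝ}
    {r : ℝ} (hr : r < 1) (hf : ContinuousOn f (closedHalfBall n))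
    (h0 : ∀ x, r < ‖x‖ → f x = 0) : ContinuousOn f {x | 0 ≤ x (Fin.last n)} := by
  intro x hx
  by_cases h : ‖x‖ < 1
  · refine (hf x ⟨h.le, hx⟩).mono_of_mem_nhdsWithin ?_
    filter_upwards [self_mem_nhdsWithin,
      mem_nhdsWithin_of_mem_nhds ((isOpen_lt continuous_norm continuous_const).mem_nhds h)]
      with y hy1 hy2
    exact ⟨le_of_lt hy2, hy1⟩
  · refine (ContinuousAt.congr (f := fun _ => (0 : ℝ)) continuousAt_const ?_).continuousWithinAt
    filter_upwards [(isOpen_lt continuous_const continuous_norm).mem_nhds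
      (show r < ‖x‖ from hr.trans_le (not_lt.1 h))] with y hy
    exact (h0 y hy).symm

/-- Divergence theorem on the half-ball for vector fields vanishing near the spherical part of
the boundary. -/
theorem integral_divergence_halfBall {n : ℕ}
    (V : Fin (n+1) → EuclideanSpace ℝ (Fin (n+1)) → ℝ) (D : EuclideanSpace ℝ (Fin (n+1)) → ℝ)
    {r : ℝ} (hr : r < 1)
    (hV : ∀ i, ContinuousOn (V i) (closedHalfBall n)) (hV0 : ∀ i x, r < ‖x‖ → V i x = 0)
    (hd : ∀ i, ∀ x ∈ {x : EuclideanSpace ℝ (Fin (n+1)) | ‖x‖ < 1 ∧ 0 < x (Fin.last n)},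
      DifferentiableAt ℝ (V i) x)
    (hD : ContinuousOn D (closedHalfBall n)) (hD0 : ∀ x, r < ‖x‖ → D x = 0)
    (hdiv : ∀ x ∈ {x : EuclideanSpace ℝ (Fin (n+1)) | ‖x‖ < 1 ∧ 0 < x (Fin.last n)},
      ∑ i, fderiv ℝ (V i) x (EuclideanSpace.single i 1) = D x) :
    ∫ x in Bplus 0 1, D x = -∫ x' in Bprime (n := n) 0 1, V (Fin.last n) (emb x') := by
  have hVz : ∀ i x, r < ‖x‖ → V i =ᶠ[nhds x] fun _ => (0 : ℝ) := fun i x hx => by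
    filter_upwards [(isOpen_lt continuous_const continuous_norm).mem_nhds hx] with y hy
    exact hV0 i y hy
  have hd' : ∀ i x, 0 < x (Fin.last n) → DifferentiableAt ℝ (V i) x := fun i x hx => by
    by_cases h : ‖x‖ < 1
    · exact hd i x ⟨h, hx⟩
    · exact (differentiableAt_const 0).congr_of_eventuallyEq (hVz i x (hr.trans_le (not_lt.1 h)))
  have hdiv' : ∀ x : EuclideanSpace ℝ (Fin (n+1)), 0 < x (Fin.last n) →
      ∑ i, fderiv ℝ (V i) x (EuclideanSpace.single i 1) = D x := fun x hx => by
    by_cases h : ‖x‖ < 1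
    · exact hdiv x ⟨h, hx⟩
    · have h' := hr.trans_le (not_lt.1 h)
      rw [hD0 x h']
      refine Finset.sum_eq_zero fun i _ => ?_
      rw [(hVz i x h').fderiv_eq]
      simp
  have hVc := fun i => (hV i).halfSpace_of_vanish hr (hV0 i)
  have hDc := hD.halfSpace_of_vanish hr hD0
  set T := (PiLp.continuousLinearEquiv 2 ℝ (fun _ : Fin (n+1) => ℝ)).symm
  have hnorm : ∀ (y : Fin (n+1) → ℝ) i, 1 ≤ |y i| → r < ‖T y‖ := fun y i h =>
    hr.trans_le (h.trans (PiLp.norm_apply_le (T y) i))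
  set a : Fin (n+1) → ℝ := Fin.snoc (fun _ : Fin n => (-1 : ℝ)) 0 with ha
  have hal : a (Fin.last n) = 0 := by simp [ha]
  have hac : ∀ i : Fin n, a i.castSucc = -1 := by simp [ha]
  have hab : a ≤ 1 := fun i => by
    refine Fin.lastCases ?_ (fun j => ?_) i
    · rw [hal]; simp
    · rw [hac]; simp
  have hbox : Set.Icc a 1 ⊆ T ⁻¹' {x | 0 ≤ x (Fin.last n)} := fun y hy => by
    have := hy.1 (Fin.last n)
    rw [hal] at this
    exact this
  have hae : (Set.univ.pi fun i => Set.Ioo (a i) ((1 : Fin (n+1) → ℝ) i)) =ᵐ[volume]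
    Set.Icc a 1 := Measure.univ_pi_Ioo_ae_eq_Icc
  have hopen : MeasurableSet (Set.univ.pi fun i => Set.Ioo (a i) ((1 : Fin (n+1) → ℝ) i)) :=
    MeasurableSet.univ_pi fun i => measurableSet_Ioo
  have hpos : ∀ y ∈ (Set.univ.pi fun i => Set.Ioo (a i) ((1 : Fin (n+1) → ℝ) i)),
      0 < T y (Fin.last n) := fun y hy => by
    have := (hy (Fin.last n) (Set.mem_univ _)).1
    rwa [hal] at this
  have hsum : ∀ y ∈ (Set.univ.pi fun i => Set.Ioo (a i) ((1 : Fin (n+1) → ℝ) i)),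
      ∑ i, fderiv ℝ (V i ∘ T) y (Pi.single i 1) = D (T y) := fun y hy => by
    rw [← hdiv' _ (hpos y hy)]
    refine Finset.sum_congr rfl fun i _ => ?_
    rw [fderiv_comp _ (hd' i _ (hpos y hy)) T.differentiableAt]
    simp only [ContinuousLinearEquiv.fderiv, ContinuousLinearMap.comp_apply]
    rfl
  have key := integral_divergence_of_hasFDerivAt_off_countable' a 1 hab (fun i => V i ∘ T)
    (fun i y => fderiv ℝ (V i ∘ T) y) ∅ Set.countable_empty
    (fun i => (hVc i).comp T.continuous.continuousOn hbox)
    (fun y hy i => ((hd' i _ (hpos y hy.1)).comp y T.differentiableAt).hasFDerivAt)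
    (by
      refine IntegrableOn.congr_set_ae ?_ hae.symm
      refine IntegrableOn.congr_fun ?_ (fun y hy => (hsum y hy).symm) hopen
      refine IntegrableOn.congr_set_ae ?_ hae
      exact (hDc.comp T.continuous.continuousOn hbox).integrableOn_compact isCompact_Icc)
  rw [← setIntegral_congr_set hae, setIntegral_congr_fun hopen hsum] at key
  have hL : ∫ y in (Set.univ.pi fun i => Set.Ioo (a i) ((1 : Fin (n+1) → ℝ) i)), D (T y) =
      ∫ x in Bplus 0 1, D x := by
    set D' := Set.indicator {x : EuclideanSpace ℝ (Fin (n+1)) | 0 < x (Fin.last n)} D with hD'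
    have h1 : ∫ y in (Set.univ.pi fun i => Set.Ioo (a i) ((1 : Fin (n+1) → ℝ) i)), D (T y) =
        ∫ y in (Set.univ.pi fun i => Set.Ioo (a i) ((1 : Fin (n+1) → ℝ) i)), D' (T y) :=
      setIntegral_congr_fun hopen fun y hy => by
        rw [hD', Set.indicator_of_mem (show T y ∈ {x | 0 < x (Fin.last n)} from hpos y hy)]
    have h2 : ∫ x in Bplus 0 1, D x = ∫ x in Bplus (n := n) 0 1, D' x :=
      setIntegral_congr_fun (measurableSet_Bplus n 1)
        fun y hy => by
          rw [hD', Set.indicator_of_mem (show y ∈ {x | 0 < x (Fin.last n)} from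
            (mem_Bplus_zero.1 hy).1)]
    rw [h1, h2, setIntegral_eq_integral_of_forall_compl_eq_zero,
      setIntegral_eq_integral_of_forall_compl_eq_zero]
    · exact (PiLp.volume_preserving_toLp (Fin (n+1))).integral_comp
        (MeasurableEquiv.toLp 2 _).measurableEmbedding D'
    · intro x hx
      rw [mem_Bplus_zero, not_and, not_le] at hx
      refine Set.indicator_apply_eq_zero.2 fun h => hD0 x (hr.trans (hx h))
    · intro y hy
      refine Set.indicator_apply_eq_zero.2 fun h => ?_
      by_contra hne
      refine hy fun i _ => ?_
      have hlt : |y i| < 1 := by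
        by_contra hge
        exact hne (hD0 _ (hnorm y i (not_lt.1 hge)))
      refine ⟨?_, (abs_lt.1 hlt).2⟩
      revert hlt
      refine Fin.lastCases ?_ (fun j => ?_) i
      · intro _; rw [hal]; exact h
      · intro hlt; rw [hac]; exact (abs_lt.1 hlt).1
  rw [hL] at key
  rw [key, Fin.sum_univ_castSucc]
  have hfront : ∀ (i : Fin (n+1)) (x : Fin n → ℝ),
      V i (T (i.insertNth ((1 : Fin (n+1) → ℝ) i) x)) = 0 := fun i x =>
    hV0 i _ (hnorm _ i (by simp))
  have hback : ∀ (i : Fin n) (x : Fin n → ℝ),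
      V i.castSucc (T (i.castSucc.insertNth (a i.castSucc) x)) = 0 := fun i x =>
    hV0 _ _ (hnorm _ i.castSucc (by simp [hac]))
  simp only [Function.comp_apply, hfront, hback, integral_zero, sub_zero, Finset.sum_const_zero,
    zero_add, zero_sub]
  simp only [hal, Fin.insertNth_last']
  congr 1
  rw [setIntegral_eq_integral_of_forall_compl_eq_zero,
      setIntegral_eq_integral_of_forall_compl_eq_zero]
  · exact (PiLp.volume_preserving_toLp (Fin n)).integral_comp
        (MeasurableEquiv.toLp 2 _).measurableEmbedding (fun x' => V (Fin.last n) (emb x'))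
  · intro x' hx'
    refine hV0 _ _ ?_
    rw [Bprime_zero, mem_closedBall_zero_iff, not_le] at hx'
    rw [norm_emb]
    exact hr.trans hx'
  · intro y hy
    by_contra hne
    refine hy ?_
    have hlt : ∀ i : Fin n, |y i| < 1 := fun i => by
      by_contra hge
      refine hne (hV0 _ _ (hnorm _ i.castSucc ?_))
      simpa using not_lt.1 hge
    refine ⟨fun i => ?_, fun i => ?_⟩
    · simp only [Function.comp_apply, Fin.succAbove_last, hac]
      exact (abs_lt.1 (hlt i)).1.le
    · exact (abs_lt.1 (hlt i)).2.le

theorem hasDerivAt_max_zero_pow (k : ℕ) (y : ℝ) :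
    HasDerivAt (fun y : ℝ => max y 0 ^ (k + 2)) ((k + 2) * max y 0 ^ (k + 1)) y := by
  rcases lt_trichotomy y 0 with h | rfl | h
  · rw [max_eq_right h.le]
    refine (hasDerivAt_const y (0 : ℝ)).congr_of_eventuallyEq ?_ |>.congr_deriv (by simp)
    filter_upwards [Iio_mem_nhds h] with z hz
    rw [max_eq_right (le_of_lt hz)]
    simp
  · rw [hasDerivAt_iff_isLittleO]
    simp only [max_self, sub_zero, ne_eq, Nat.add_eq_zero_iff, one_ne_zero, and_false,
      not_false_eq_true, zero_pow, mul_zero, smul_zero, OfNat.ofNat_ne_zero]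
    refine Asymptotics.IsBigO.trans_isLittleO (g := fun y : ℝ => y ^ (k + 2)) ?_
      (by simpa using Asymptotics.isLittleO_pow_pow (𝕜 := ℝ) (m := 1) (n := k + 2) (by omega))
    refine Asymptotics.IsBigO.of_bound 1 (Filter.Eventually.of_forall fun z => ?_)
    rw [one_mul, norm_pow, norm_pow]
    refine pow_le_pow_left₀ (norm_nonneg _) ?_ _
    rw [Real.norm_eq_abs, Real.norm_eq_abs, abs_of_nonneg (le_max_right _ _)]
    exact max_le (le_abs_self _) (abs_nonneg _)
  · rw [max_eq_left h.le]
    refine ((hasDerivAt_pow (k + 2) y).congr_of_eventuallyEq ?_).congr_deriv (by push_cast; rfl)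
    filter_upwards [Ioi_mem_nhds h] with z hz
    rw [max_eq_left (le_of_lt hz)]

/-- The positive part of `s² - |x - c|²`. -/
noncomputable def paraboloid {m : ℕ} (s : ℝ) (c x : EuclideanSpace ℝ (Fin m)) : ℝ :=
  max (s ^ 2 - ‖x - c‖ ^ 2) 0

theorem paraboloid_nonneg {m : ℕ} (s : ℝ) (c x : EuclideanSpace ℝ (Fin m)) :
    0 ≤ paraboloid s c x :=
  le_max_right _ _

theorem paraboloid_le {m : ℕ} (s : ℝ) (c x : EuclideanSpace ℝ (Fin m)) :
    paraboloid s c x ≤ s ^ 2 :=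
  max_le (by nlinarith [sq_nonneg ‖x - c‖]) (sq_nonneg s)

theorem paraboloid_eq_zero {m : ℕ} {s : ℝ} (hs : 0 ≤ s) {c x : EuclideanSpace ℝ (Fin m)}
    (h : s ≤ ‖x - c‖) : paraboloid s c x = 0 :=
  max_eq_right (by nlinarith)

theorem paraboloid_mul_sq {m : ℕ} (s : ℝ) (c x : EuclideanSpace ℝ (Fin m)) :
    paraboloid s c x * ‖x - c‖ ^ 2 = s ^ 2 * paraboloid s c x - paraboloid s c x ^ 2 := by
  unfold paraboloid
  rcases max_choice (s ^ 2 - ‖x - c‖ ^ 2) 0 with h | h <;> rw [h] <;> ring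

theorem continuous_paraboloid {m : ℕ} (s : ℝ) (c : EuclideanSpace ℝ (Fin m)) :
    Continuous (paraboloid s c) := by
  unfold paraboloid
  fun_prop

theorem hasFDerivAt_paraboloid_pow {m : ℕ} (k : ℕ) (s : ℝ) (c x : EuclideanSpace ℝ (Fin m)) :
    HasFDerivAt (fun y => paraboloid s c y ^ (k + 2))
      (((k + 2) * paraboloid s c x ^ (k + 1)) •
        (-(2 • innerSL ℝ (x - c)) : EuclideanSpace ℝ (Fin m) →L[ℝ] ℝ)) x := by
  have h : HasFDerivAt (fun y => s ^ 2 - ‖y - c‖ ^ 2)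
        (-(2 • innerSL ℝ (x - c)) : EuclideanSpace ℝ (Fin m) →L[ℝ] ℝ) x := by
    have := (((hasFDerivAt_id x).sub_const c).norm_sq).const_sub (s ^ 2)
    simpa using this
  exact (hasDerivAt_max_zero_pow k _).comp_hasFDerivAt x h

theorem hasDerivAt_paraboloid_pow {m : ℕ} (k : ℕ) (s : ℝ) (c x : EuclideanSpace ℝ (Fin m)) :
    HasDerivAt (fun s => paraboloid s c x ^ (k + 2))
      ((k + 2) * paraboloid s c x ^ (k + 1) * (2 * s)) s := by
  have h : HasDerivAt (fun s : ℝ => s ^ 2 - ‖x - c‖ ^ 2) (2 * s) s := by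
    simpa using (hasDerivAt_pow 2 s).sub_const (‖x - c‖ ^ 2)
  exact (hasDerivAt_max_zero_pow k _).comp s h

/-- The `i`-th partial derivative of the cube of the paraboloid. -/
noncomputable def paraboloidGrad {m : ℕ} (s : ℝ) (c : EuclideanSpace ℝ (Fin m)) (i : Fin m)
    (x : EuclideanSpace ℝ (Fin m)) : ℝ :=
  -6 * paraboloid s c x ^ 2 * (x i - c i)

/-- The Laplacian of the cube of the paraboloid. -/
noncomputable def paraboloidLapl {m : ℕ} (s : ℝ) (c x : EuclideanSpace ℝ (Fin m)) : ℝ :=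
  24 * s ^ 2 * paraboloid s c x - 6 * (m + 4) * paraboloid s c x ^ 2

theorem differentiableAt_paraboloid_pow {m : ℕ} (k : ℕ) (s : ℝ)
    (c x : EuclideanSpace ℝ (Fin m)) :
    DifferentiableAt ℝ (fun y => paraboloid s c y ^ (k + 2)) x :=
  (hasFDerivAt_paraboloid_pow k s c x).differentiableAt

theorem fderiv_paraboloid_pow_single {m : ℕ} (k : ℕ) (s : ℝ) (c x : EuclideanSpace ℝ (Fin m))
    (i : Fin m) :
    fderiv ℝ (fun y => paraboloid s c y ^ (k + 2)) x (EuclideanSpace.single i 1) =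
      (k + 2) * paraboloid s c x ^ (k + 1) * (-2 * (x i - c i)) := by
  rw [(hasFDerivAt_paraboloid_pow k s c x).fderiv]
  simp [EuclideanSpace.inner_single_right]

theorem differentiableAt_paraboloidGrad {m : ℕ} (s : ℝ) (c x : EuclideanSpace ℝ (Fin m))
    (i : Fin m) : DifferentiableAt ℝ (paraboloidGrad s c i) x := by
  have h := differentiableAt_paraboloid_pow 0 s c x
  simp only [zero_add] at h
  unfold paraboloidGrad
  fun_prop

theorem continuous_paraboloidGrad {m : ℕ} (s : ℝ) (c : EuclideanSpace ℝ (Fin m))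
    (i : Fin m) : Continuous (paraboloidGrad s c i) :=
  continuous_iff_continuousAt.2 fun x => (differentiableAt_paraboloidGrad s c x i).continuousAt

theorem fderiv_paraboloid_cube_single {m : ℕ} (s : ℝ) (c x : EuclideanSpace ℝ (Fin m))
    (i : Fin m) :
    fderiv ℝ (fun y => paraboloid s c y ^ 3) x (EuclideanSpace.single i 1) =
      paraboloidGrad s c i x := by
  have := fderiv_paraboloid_pow_single 1 s c x i
  norm_num at this
  rw [this, paraboloidGrad]
  ring

theorem sum_fderiv_paraboloidGrad {m : ℕ} (s : ℝ) (c x : EuclideanSpace ℝ (Fin m)) :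
    ∑ i, fderiv ℝ (paraboloidGrad s c i) x (EuclideanSpace.single i 1) =
      paraboloidLapl s c x := by
  have h : ∀ i, fderiv ℝ (paraboloidGrad s c i) x (EuclideanSpace.single i 1) =
      24 * (paraboloid s c x * (x i - c i) ^ 2) - 6 * paraboloid s c x ^ 2 := fun i => by
    have h1 := differentiableAt_paraboloid_pow 0 s c x
    have h2 := fderiv_paraboloid_pow_single 0 s c x i
    norm_num at h1 h2
    have h3 : HasFDerivAt (fun y : EuclideanSpace ℝ (Fin m) => y i - c i)
        (EuclideanSpace.proj i : EuclideanSpace ℝ (Fin m) →L[ℝ] ℝ) x :=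
      (EuclideanSpace.proj i : EuclideanSpace ℝ (Fin m) →L[ℝ] ℝ).hasFDerivAt.sub_const _
    have h4 := ((h1.hasFDerivAt.const_mul (-6)).mul h3).fderiv
    refine (congrArg (fun L => L (EuclideanSpace.single i (1 : ℝ))) h4).trans ?_
    simp [h2]
    ring
  simp_rw [h]
  rw [Finset.sum_sub_distrib, ← Finset.mul_sum, ← Finset.mul_sum]
  have : ∑ i, (x i - c i) ^ 2 = ‖x - c‖ ^ 2 := by
    rw [EuclideanSpace.norm_sq_eq]; simp
  rw [this, paraboloid_mul_sq]
  simp [paraboloidLapl]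
  ring

/-- Green's second identity on the half-ball, for a harmonic function and the sum of two bumps
centred at points that are mirror images in the flat boundary. -/
theorem integral_mul_paraboloidLapl {n : ℕ} {u : EuclideanSpace ℝ (Fin (n+1)) → ℝ}
    (hu : ContDiffOn ℝ 1 u (closedHalfBall n))
    (hharm : HarmonicOnSet u {x | ‖x‖ < 1 ∧ 0 < x (Fin.last n)})
    {a b : EuclideanSpace ℝ (Fin (n+1))} (ha : ‖a‖ ≤ 1/4) (hb : ‖b‖ ≤ 1/4)
    (hlast : b (Fin.last n) = -a (Fin.last n)) (hdist : ∀ x', ‖emb x' - b‖ = ‖emb x' - a‖)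
    {s : ℝ} (hs0 : 0 ≤ s) (hs : s ≤ 1/2) :
    ∫ x in Bplus 0 1, u x * (paraboloidLapl s a x + paraboloidLapl s b x) =
      ∫ x' in Bprime (n := n) 0 1, 2 * paraboloid s a (emb x') ^ 3 *
        fderivWithin ℝ u (closedHalfBall n) (emb x') (EuclideanSpace.single (Fin.last n) 1) := by
  have hvan : ∀ c : EuclideanSpace ℝ (Fin (n+1)), ‖c‖ ≤ 1/4 → ∀ x, 3/4 < ‖x‖ →
      paraboloid s c x = 0 := fun c hc x hx => by
    refine paraboloid_eq_zero hs0 ?_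
    have := norm_sub_norm_le x c
    linarith
  have hdu : ContinuousOn (fderivWithin ℝ u (closedHalfBall n)) (closedHalfBall n) :=
    hu.continuousOn_fderivWithin (uniqueDiffOn_closedHalfBall n) le_rfl
  have hnhds : ∀ x : EuclideanSpace ℝ (Fin (n+1)),
      x ∈ {x : EuclideanSpace ℝ (Fin (n+1)) | ‖x‖ < 1 ∧ 0 < x (Fin.last n)} →
      ∀ᶠ y in nhds x, y ∈ {x : EuclideanSpace ℝ (Fin (n+1)) | ‖x‖ < 1 ∧ 0 < x (Fin.last n)} :=
    fun x hx => (isOpen_openHalfBall n).mem_nhds hx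
  have hfd : ∀ x ∈ {x : EuclideanSpace ℝ (Fin (n+1)) | ‖x‖ < 1 ∧ 0 < x (Fin.last n)},
      fderivWithin ℝ u (closedHalfBall n) x = fderiv ℝ u x := fun x hx =>
    fderivWithin_of_mem_nhds (Filter.mem_of_superset (hnhds x hx) (openHalfBall_subset n))
  have hfd' : ∀ i, ∀ x ∈ {x : EuclideanSpace ℝ (Fin (n+1)) | ‖x‖ < 1 ∧ 0 < x (Fin.last n)},
      (fun y => fderivWithin ℝ u (closedHalfBall n) y (EuclideanSpace.single i 1)) =ᶠ[nhds x]
        fun y => fderiv ℝ u y (EuclideanSpace.single i 1) := fun i x hx => by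
    filter_upwards [hnhds x hx] with y hy
    rw [hfd y hy]
  have hu2 : ∀ x ∈ {x : EuclideanSpace ℝ (Fin (n+1)) | ‖x‖ < 1 ∧ 0 < x (Fin.last n)},
      ContDiffAt ℝ 2 u x := fun x hx => hharm.1.contDiffAt (hnhds x hx)
  have hdd : ∀ i, ∀ x ∈ {x : EuclideanSpace ℝ (Fin (n+1)) | ‖x‖ < 1 ∧ 0 < x (Fin.last n)},
      DifferentiableAt ℝ (fun y => fderiv ℝ u y (EuclideanSpace.single i 1)) x := fun i x hx => by
    have := ((hu2 x hx).fderiv_right (m := 1) (by norm_num)).differentiableAt (by norm_num)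
    exact this.clm_apply (differentiableAt_const _)
  have hdd' : ∀ i, ∀ x ∈ {x : EuclideanSpace ℝ (Fin (n+1)) | ‖x‖ < 1 ∧ 0 < x (Fin.last n)},
      DifferentiableAt ℝ (fun y => fderivWithin ℝ u (closedHalfBall n) y
        (EuclideanSpace.single i 1)) x := fun i x hx =>
    (hdd i x hx).congr_of_eventuallyEq (hfd' i x hx)
  have hgr : ∀ c i, ∀ x, DifferentiableAt ℝ (paraboloidGrad s c i) x := fun c i x =>
    differentiableAt_paraboloidGrad (m := n + 1) s c x i
  have hcube : ∀ c : EuclideanSpace ℝ (Fin (n+1)), ∀ x,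
      DifferentiableAt ℝ (fun y => paraboloid s c y ^ 3) x := fun c x =>
    differentiableAt_paraboloid_pow 1 s c x
  have hud : ∀ x ∈ {x : EuclideanSpace ℝ (Fin (n+1)) | ‖x‖ < 1 ∧ 0 < x (Fin.last n)},
      DifferentiableAt ℝ u x := fun x hx => (hu2 x hx).differentiableAt (by norm_num)
  have key := integral_divergence_halfBall (n := n) (r := 3/4)
    (fun i x => u x * (paraboloidGrad s a i x + paraboloidGrad s b i x) -
      (paraboloid s a x ^ 3 + paraboloid s b x ^ 3) *
        fderivWithin ℝ u (closedHalfBall n) x (EuclideanSpace.single i 1))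
    (fun x => u x * (paraboloidLapl s a x + paraboloidLapl s b x)) (by norm_num)
    (fun i => by
      have h1 := continuous_paraboloidGrad s a i
      have h2 := continuous_paraboloidGrad s b i
      have h3 := continuous_paraboloid s a
      have h4 := continuous_paraboloid s b
      have h5 := hu.continuousOn
      fun_prop)
    (fun i x hx => by
      simp [paraboloidGrad, hvan a ha x hx, hvan b hb x hx])
    (fun i x hx => ((hud x hx).mul ((hgr a i x).add (hgr b i x))).sub
      (((hcube a x).add (hcube b x)).mul (hdd' i x hx)))
    (by
      have h3 := continuous_paraboloid s a
      have h4 := continuous_paraboloid s b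
      have h5 := hu.continuousOn
      unfold paraboloidLapl
      fun_prop)
    (fun x hx => by
      simp [paraboloidLapl, hvan a ha x hx, hvan b hb x hx])
    (fun x hx => by
      have h : ∀ i, fderiv ℝ (fun x => u x * (paraboloidGrad s a i x + paraboloidGrad s b i x) -
          (paraboloid s a x ^ 3 + paraboloid s b x ^ 3) *
          fderivWithin ℝ u (closedHalfBall n) x (EuclideanSpace.single i 1)) x
          (EuclideanSpace.single i 1) =
          u x * (fderiv ℝ (paraboloidGrad s a i) x (EuclideanSpace.single i 1) +
            fderiv ℝ (paraboloidGrad s b i) x (EuclideanSpace.single i 1)) -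
          (paraboloid s a x ^ 3 + paraboloid s b x ^ 3) *
            fderiv ℝ (fun y => fderiv ℝ u y (EuclideanSpace.single i 1)) x
              (EuclideanSpace.single i 1) := fun i => by
        have h1 := (((hud x hx).hasFDerivAt.mul ((hgr a i x).hasFDerivAt.add
          (hgr b i x).hasFDerivAt)).sub
            (((hcube a x).hasFDerivAt.add (hcube b x).hasFDerivAt).mul
              (hdd' i x hx).hasFDerivAt)).fderiv
        refine (congrArg (fun L => L (EuclideanSpace.single i (1 : ℝ))) h1).trans ?_
        rw [(hfd' i x hx).fderiv_eq, hfd x hx]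
        simp [fderiv_paraboloid_cube_single]
        ring
      simp_rw [h]
      rw [Finset.sum_sub_distrib, ← Finset.mul_sum, ← Finset.mul_sum, Finset.sum_add_distrib,
        sum_fderiv_paraboloidGrad, sum_fderiv_paraboloidGrad]
      have := hharm.2 x hx
      unfold lapl at this
      rw [this]
      simp)
  rw [key, ← integral_neg]
  congr 1
  ext x'
  have hP : paraboloid s b (emb x') = paraboloid s a (emb x') := by
    simp only [paraboloid, hdist]
  simp only [paraboloidGrad, hP, emb_last, hlast]
  ring

/-- Hölder's inequality, comparing the `L¹` norm on a set of finite measure with the `Lᵖ` norm. -/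
theorem setIntegral_abs_le_LpnormOn {m : ℕ} {f : EuclideanSpace ℝ (Fin m) → ℝ} {p : ℝ}
    (hp : 1 ≤ p) {S T : Set (EuclideanSpace ℝ (Fin m))} (hST : S ⊆ T)
    (hT : MeasurableSet T) (hTfin : volume T ≠ ⊤)
    (hf : AEStronglyMeasurable f (volume.restrict T)) {B : ℝ} (hB : ∀ x ∈ T, |f x| ≤ B) :
    ∫ x in S, |f x| ≤ volume.real S ^ (1 - 1 / p) * LpnormOn f p T := by
  have hp0 : 0 < p := by linarith
  have hfS := hf.mono_measure (Measure.restrict_mono hST le_rfl)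
  have hSfin : volume S ≠ ⊤ := ne_top_of_le_ne_top hTfin (measure_mono hST)
  have hpow : ∀ x, ENNReal.ofReal (|f x| ^ p) = ‖f x‖ₑ ^ p := fun x => by
    rw [← ENNReal.ofReal_rpow_of_nonneg (abs_nonneg _) hp0.le, ← Real.enorm_eq_ofReal_abs]
  have hfin : ∫⁻ x in T, ENNReal.ofReal (|f x| ^ p) ≠ ⊤ := by
    refine ne_top_of_le_ne_top (b := ENNReal.ofReal (B ^ p) * volume T) ?_ ?_
    · exact ENNReal.mul_ne_top ENNReal.ofReal_ne_top hTfin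
    · rw [← setLIntegral_const]
      refine setLIntegral_mono' hT fun x hx => ENNReal.ofReal_le_ofReal ?_
      exact Real.rpow_le_rpow (abs_nonneg _) (hB x hx) hp0.le
  have h1 := eLpNorm_le_eLpNorm_mul_rpow_measure_univ (μ := volume.restrict S) (f := f)
    (p := 1) (q := ENNReal.ofReal p) (by simpa using hp) hfS
  have h2 : eLpNorm f (ENNReal.ofReal p) (volume.restrict S) ≤
      (∫⁻ x in T, ENNReal.ofReal (|f x| ^ p)) ^ (1 / p) := by
    refine (eLpNorm_mono_measure f (Measure.restrict_mono hST le_rfl)).trans_eq ?_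
    rw [eLpNorm_eq_lintegral_rpow_enorm_toReal (by simpa using hp0) ENNReal.ofReal_ne_top,
      ENNReal.toReal_ofReal hp0.le]
    simp_rw [hpow]
  rw [eLpNorm_one_eq_lintegral_enorm, Measure.restrict_apply_univ, ENNReal.toReal_one,
    ENNReal.toReal_ofReal hp0.le] at h1
  have h3 := h1.trans (mul_le_mul_left h2 _)
  have hexp : 0 ≤ 1 - 1 / p := by
    rw [sub_nonneg, div_le_one hp0]; exact hp
  have h4 := ENNReal.toReal_mono (ENNReal.mul_ne_top
    (ENNReal.rpow_ne_top_of_nonneg (by positivity) hfin)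
    (ENNReal.rpow_ne_top_of_nonneg (by simpa using hexp) hSfin)) h3
  rw [ENNReal.toReal_mul, ← ENNReal.toReal_rpow, ← ENNReal.toReal_rpow,
    ← integral_norm_eq_lintegral_enorm hfS] at h4
  simpa [LpnormOn, Measure.real, mul_comm] using h4

/-- A function whose derivative is bounded by an integrable power is bounded near zero. -/
theorem abs_le_of_deriv_le_rpow {M M' : ℝ → ℝ} {A q r : ℝ} (hA : 0 ≤ A) (hq : 0 < q)
    (hM : ∀ s ∈ Set.Ioc 0 r, HasDerivAt M (M' s) s)
    (hM' : ∀ s ∈ Set.Ioc 0 r, |M' s| ≤ A * s ^ (q - 1)) {s : ℝ} (hs : s ∈ Set.Ioc 0 r) :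
    |M s| ≤ |M r| + A / q * r ^ q := by
  have hsub : ∀ t ∈ Set.Icc s r, t ∈ Set.Ioc 0 r := fun t ht => ⟨hs.1.trans_le ht.1, ht.2⟩
  have hN : ∀ t ∈ Set.Icc s r, HasDerivAt (fun t => A / q * t ^ q - A / q * s ^ q)
      (A * t ^ (q - 1)) t := fun t ht => by
    have := ((Real.hasDerivAt_rpow_const (x := t) (p := q)
      (Or.inl (hsub t ht).1.ne')).const_mul (A / q)).sub_const (A / q * s ^ q)
    refine this.congr_deriv ?_
    field_simp
  have key := image_norm_le_of_norm_deriv_right_le_deriv_boundary'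
    (f := fun t => M t - M s) (f' := M') (a := s) (b := r)
    (B := fun t => A / q * t ^ q - A / q * s ^ q) (B' := fun t => A * t ^ (q - 1))
    (fun t ht => ((hM t (hsub t ht)).sub_const _).continuousAt.continuousWithinAt)
    (fun t ht => ((hM t (hsub t ⟨ht.1, ht.2.le⟩)).sub_const _).hasDerivWithinAt)
    (by simp)
    (fun t ht => (hN t ht).continuousAt.continuousWithinAt)
    (fun t ht => (hN t ⟨ht.1, ht.2.le⟩).hasDerivWithinAt)
    (fun t ht => hM' t (hsub t ⟨ht.1, ht.2.le⟩)) (Set.right_mem_Icc.2 hs.2)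
  rw [Real.norm_eq_abs] at key
  have h1 : 0 ≤ A / q * s ^ q := mul_nonneg (div_nonneg hA hq.le) (Real.rpow_nonneg hs.1.le _)
  have h2 := abs_sub_abs_le_abs_sub (M s) (M r)
  rw [abs_sub_comm] at h2
  linarith

theorem integral_paraboloid_sq {m : ℕ} {s : ℝ} (hs : 0 < s) (c : EuclideanSpace ℝ (Fin m)) :
    ∫ x, paraboloid s c x ^ 2 =
      s ^ (m + 4) * ∫ x : EuclideanSpace ℝ (Fin m), paraboloid 1 0 x ^ 2 := by
  have h : ∀ x, paraboloid s c x ^ 2 = s ^ 4 * paraboloid 1 0 (s⁻¹ • (x - c)) ^ 2 := fun x => by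
    have : paraboloid s c x = s ^ 2 * paraboloid 1 0 (s⁻¹ • (x - c)) := by
      unfold paraboloid
      rw [mul_max_of_nonneg _ _ (sq_nonneg s), sub_zero, norm_smul, Real.norm_eq_abs,
        abs_of_pos (inv_pos.2 hs)]
      congr 1
      · field_simp
      · simp
    rw [this]; ring
  simp_rw [h]
  rw [integral_const_mul, integral_sub_right_eq_self
    (fun x => paraboloid 1 (0 : EuclideanSpace ℝ (Fin m)) (s⁻¹ • x) ^ 2),
    Measure.integral_comp_inv_smul_of_nonneg volume (fun x => paraboloid 1 0 x ^ 2) hs.le]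
  simp
  ring

theorem integral_paraboloid_sq_pos (m : ℕ) :
    0 < ∫ x : EuclideanSpace ℝ (Fin m), paraboloid 1 0 x ^ 2 := by
  refine Continuous.integral_pos_of_hasCompactSupport_nonneg_nonzero (x := 0)
    ((continuous_paraboloid 1 0).pow 2) ?_ (fun x => sq_nonneg _) (by simp [paraboloid])
  refine HasCompactSupport.of_support_subset_isCompact (isCompact_closedBall 0 1) fun x hx => ?_
  rw [mem_closedBall_iff_norm]
  by_contra h
  exact hx (by simp [paraboloid_eq_zero zero_le_one (not_le.1 h).le])

/-- The weighted integral of `u` over the half-ball whose weight is the sum of two bumps of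
width `s` centred at `a` and `b`. -/
noncomputable def bumpIntegral {n : ℕ} (u : EuclideanSpace ℝ (Fin (n+1)) → ℝ)
    (a b : EuclideanSpace ℝ (Fin (n+1))) (s : ℝ) : ℝ :=
  ∫ x in Bplus 0 1, u x * (paraboloid s a x ^ 2 + paraboloid s b x ^ 2)

theorem ContinuousOn.integrableOn_Bplus {n : ℕ} {f : EuclideanSpace ℝ (Fin (n+1)) → ℝ}
    (hf : ContinuousOn f (closedHalfBall n)) : IntegrableOn f (Bplus 0 1) :=
  (hf.integrableOn_compact (isCompact_closedHalfBall n)).mono_set (Bplus_subset_closedHalfBall n)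

theorem hasDerivAt_bumpIntegral {n : ℕ} {u : EuclideanSpace ℝ (Fin (n+1)) → ℝ}
    (hu : ContinuousOn u (closedHalfBall n)) (a b : EuclideanSpace ℝ (Fin (n+1)))
    {s : ℝ} (hs : s ∈ Set.Ioo (0 : ℝ) 1) :
    HasDerivAt (bumpIntegral u a b)
      (∫ x in Bplus 0 1, u x * (4 * s * (paraboloid s a x + paraboloid s b x))) s := by
  have hP := fun t : ℝ => continuous_paraboloid (m := n + 1) t
  refine (hasDerivAt_integral_of_dominated_loc_of_deriv_le
    (F' := fun t x => u x * (4 * t * (paraboloid t a x + paraboloid t b x)))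
    (bound := fun x => |u x| * 8) (Ioo_mem_nhds hs.1 hs.2)
    (Filter.Eventually.of_forall fun t => ?_) ?_ ?_ ?_ ?_ ?_).2
  · have ha := hP t a
    have hb := hP t b
    exact (ContinuousOn.integrableOn_Bplus (by fun_prop)).aestronglyMeasurable
  · have ha := hP s a
    have hb := hP s b
    exact ContinuousOn.integrableOn_Bplus (by fun_prop)
  · have ha := hP s a
    have hb := hP s b
    exact (ContinuousOn.integrableOn_Bplus (by fun_prop)).aestronglyMeasurable
  · refine Filter.Eventually.of_forall fun x t ht => ?_
    rw [norm_mul, Real.norm_eq_abs, Real.norm_eq_abs]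
    refine mul_le_mul_of_nonneg_left ?_ (abs_nonneg _)
    have h1 := paraboloid_nonneg t a x
    have h2 := paraboloid_nonneg t b x
    have h3 := paraboloid_le t a x
    have h4 := paraboloid_le t b x
    have h5 : t ^ 2 ≤ 1 := by nlinarith [ht.1, ht.2]
    rw [abs_of_nonneg (mul_nonneg (by linarith [ht.1]) (add_nonneg h1 h2))]
    nlinarith [ht.1, ht.2]
  · exact (ContinuousOn.integrableOn_Bplus (by fun_prop))
  · refine Filter.Eventually.of_forall fun x t _ => ?_
    have h1 := hasDerivAt_paraboloid_pow 0 t a x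
    have h2 := hasDerivAt_paraboloid_pow 0 t b x
    refine ((h1.add h2).const_mul (u x)).congr_deriv ?_
    simp only [Nat.cast_zero, zero_add, pow_one]
    ring

/-- The derivative of the rescaled weighted integral is a boundary integral. -/
theorem hasDerivAt_rescaled_bumpIntegral {n : ℕ} {u : EuclideanSpace ℝ (Fin (n+1)) → ℝ}
    (hu : ContDiffOn ℝ 1 u (closedHalfBall n))
    (hharm : HarmonicOnSet u {x | ‖x‖ < 1 ∧ 0 < x (Fin.last n)})
    {a b : EuclideanSpace ℝ (Fin (n+1))} (ha : ‖a‖ ≤ 1/4) (hb : ‖b‖ ≤ 1/4)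
    (hlast : b (Fin.last n) = -a (Fin.last n)) (hdist : ∀ x', ‖emb x' - b‖ = ‖emb x' - a‖)
    {s : ℝ} (hs : s ∈ Set.Ioc (0 : ℝ) (1/2)) :
    HasDerivAt (fun s => (s ^ (n + 5))⁻¹ * bumpIntegral u a b s)
      ((6 * s ^ (n + 6))⁻¹ * ∫ x' in Bprime (n := n) 0 1, 2 * paraboloid s a (emb x') ^ 3 *
        fderivWithin ℝ u (closedHalfBall n) (emb x') (EuclideanSpace.single (Fin.last n) 1)) s := by
  have hs0 := hs.1.ne'
  have h1 := hasDerivAt_bumpIntegral hu.continuousOn a b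
    (s := s) ⟨hs.1, hs.2.trans_lt (by norm_num)⟩
  refine (((hasDerivAt_pow (n + 5) s).inv (pow_ne_zero _ hs0)).mul h1).congr_deriv ?_
  rw [← integral_mul_paraboloidLapl hu hharm ha hb hlast hdist hs.1.le hs.2]
  have hcont := hu.continuousOn
  have hPa := continuous_paraboloid (m := n + 1) s a
  have hPb := continuous_paraboloid (m := n + 1) s b
  have h2 : ∫ x in Bplus 0 1, u x * (paraboloidLapl s a x + paraboloidLapl s b x) =
      6 * s * (∫ x in Bplus 0 1, u x * (4 * s * (paraboloid s a x + paraboloid s b x))) -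
        6 * (n + 5) * bumpIntegral u a b s := by
    rw [bumpIntegral, ← integral_const_mul, ← integral_const_mul, ← integral_sub]
    · congr 1
      ext x
      simp only [paraboloidLapl]
      push_cast
      ring
    · exact ContinuousOn.integrableOn_Bplus (by fun_prop)
    · exact ContinuousOn.integrableOn_Bplus (by fun_prop)
  rw [h2]
  simp only [Pi.inv_apply]
  field_simp
  push_cast
  ring_nf

/-- The orthogonal projection onto the flat boundary. -/
noncomputable def flatProj {n : ℕ} (a : EuclideanSpace ℝ (Fin (n+1))) :
    EuclideanSpace ℝ (Fin n) :=
  WithLp.toLp 2 fun j => a j.castSucc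

/-- The reflection across the flat boundary. -/
noncomputable def flatReflect {n : ℕ} (a : EuclideanSpace ℝ (Fin (n+1))) :
    EuclideanSpace ℝ (Fin (n+1)) :=
  a - (2 * a (Fin.last n)) • EuclideanSpace.single (Fin.last n) 1

theorem flatReflect_last {n : ℕ} (a : EuclideanSpace ℝ (Fin (n+1))) :
    flatReflect a (Fin.last n) = -a (Fin.last n) := by
  simp [flatReflect]; ring

theorem flatReflect_castSucc {n : ℕ} (a : EuclideanSpace ℝ (Fin (n+1))) (j : Fin n) :
    flatReflect a j.castSucc = a j.castSucc := by
  simp [flatReflect, Fin.castSucc_ne_last]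

theorem norm_flatReflect {n : ℕ} (a : EuclideanSpace ℝ (Fin (n+1))) :
    ‖flatReflect a‖ = ‖a‖ := by
  simp [EuclideanSpace.norm_eq, Fin.sum_univ_castSucc, flatReflect_last, flatReflect_castSucc]

theorem norm_emb_sub_flatReflect {n : ℕ} (a : EuclideanSpace ℝ (Fin (n+1)))
    (x' : EuclideanSpace ℝ (Fin n)) : ‖emb x' - flatReflect a‖ = ‖emb x' - a‖ := by
  simp [EuclideanSpace.norm_eq, Fin.sum_univ_castSucc, flatReflect_last, flatReflect_castSucc,
    emb_last]

theorem norm_sub_flatProj_le {n : ℕ} (a : EuclideanSpace ℝ (Fin (n+1)))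
    (x' : EuclideanSpace ℝ (Fin n)) : ‖x' - flatProj a‖ ≤ ‖emb x' - a‖ := by
  rw [EuclideanSpace.norm_eq, EuclideanSpace.norm_eq, Fin.sum_univ_castSucc]
  refine Real.sqrt_le_sqrt ?_
  simp [flatProj, emb_castSucc, sq_nonneg]

theorem abs_boundary_integral_le {n : ℕ} (hn : 1 ≤ n) {p : ℝ} (hp : (n : ℝ) < p)
    {g : EuclideanSpace ℝ (Fin n) → ℝ} (hg : ContinuousOn g (Bprime 0 1))
    {a : EuclideanSpace ℝ (Fin (n+1))} (ha : ‖a‖ ≤ 1/4) {s : ℝ}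
    (hs : s ∈ Set.Ioc (0 : ℝ) (1/2)) :
    |∫ x' in Bprime 0 1, 2 * paraboloid s a (emb x') ^ 3 * g x'| ≤
      2 * s ^ 6 * (s ^ (n - n / p) *
        volume.real (Metric.closedBall (0 : EuclideanSpace ℝ (Fin n)) 1) ^ (1 - 1 / p) *
          LpnormOn g p (Bprime 0 1)) := by
  have hn1 : (1 : ℝ) ≤ n := by exact_mod_cast hn
  have hp0 : 0 < p := by linarith
  have hcpt : IsCompact (Bprime (n := n) 0 1) := by
    rw [Bprime_zero]; exact isCompact_closedBall _ _
  obtain ⟨B, hB⟩ := hcpt.exists_bound_of_continuousOn hg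
  have hproj : ‖flatProj a‖ ≤ 1/4 := by
    have := norm_sub_flatProj_le a 0
    rw [zero_sub, norm_neg] at this
    refine this.trans ?_
    have h0 : emb (0 : EuclideanSpace ℝ (Fin n)) = 0 := by
      rw [← norm_eq_zero, norm_emb, norm_zero]
    rwa [h0, zero_sub, norm_neg]
  have hsub : Metric.closedBall (flatProj a) s ⊆ Bprime 0 1 := by
    rw [Bprime_zero]
    intro x hx
    rw [mem_closedBall_iff_norm] at hx
    rw [mem_closedBall_zero_iff]
    have := norm_le_insert' x (flatProj a)
    linarith [hs.2]
  have hholder := setIntegral_abs_le_LpnormOn (f := g) (p := p) (by linarith) hsub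
    hcpt.measurableSet hcpt.measure_lt_top.ne (hg.aestronglyMeasurable hcpt.measurableSet)
    (fun x hx => hB x hx)
  have hvol : volume.real (Metric.closedBall (flatProj a) s) ^ (1 - 1 / p) = s ^ (n - n / p) *
      volume.real (Metric.closedBall (0 : EuclideanSpace ℝ (Fin n)) 1) ^ (1 - 1 / p) := by
    rw [Measure.addHaar_real_closedBall' _ _ hs.1.le, finrank_euclideanSpace_fin,
      Real.mul_rpow (pow_nonneg hs.1.le _) measureReal_nonneg, ← Real.rpow_natCast,
      ← Real.rpow_mul hs.1.le]
    congr 2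
    ring
  rw [hvol] at hholder
  refine le_trans ?_ (mul_le_mul_of_nonneg_left hholder (by have := hs.1; positivity))
  rw [← integral_const_mul]
  have hpt : ∀ x' ∈ Bprime (n := n) 0 1, ‖2 * paraboloid s a (emb x') ^ 3 * g x'‖ ≤
      (Metric.closedBall (flatProj a) s).indicator (fun x' => 2 * s ^ 6 * |g x'|) x' := by
    intro x' _
    by_cases hx : x' ∈ Metric.closedBall (flatProj a) s
    · rw [Set.indicator_of_mem hx, norm_mul, Real.norm_eq_abs, Real.norm_eq_abs]
      refine mul_le_mul_of_nonneg_right ?_ (abs_nonneg _)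
      have h0 := paraboloid_nonneg s a (emb x')
      rw [abs_of_nonneg (by positivity)]
      have := pow_le_pow_left₀ h0 (paraboloid_le s a (emb x')) 3
      nlinarith
    · rw [Set.indicator_of_notMem hx]
      rw [mem_closedBall_iff_norm, not_le] at hx
      rw [paraboloid_eq_zero hs.1.le (hx.le.trans (norm_sub_flatProj_le a x'))]
      simp
  have hint : IntegrableOn (fun x' => 2 * s ^ 6 * |g x'|) (Bprime (n := n) 0 1) :=
    ContinuousOn.integrableOn_compact hcpt (by fun_prop)
  calc _ ≤ ∫ x' in Bprime (n := n) 0 1,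
        (Metric.closedBall (flatProj a) s).indicator (fun x' => 2 * s ^ 6 * |g x'|) x' := by
        rw [← Real.norm_eq_abs]
        refine norm_integral_le_of_norm_le
          (hint.indicator Metric.isClosed_closedBall.measurableSet) ?_
        exact (ae_restrict_iff' hcpt.measurableSet).2 (Filter.Eventually.of_forall hpt)
    _ = _ := by
        rw [setIntegral_indicator Metric.isClosed_closedBall.measurableSet,
          Set.inter_eq_right.2 hsub]

/-- The weighted averages of `u` at an interior point recover its value there. -/
theorem abs_mul_le_of_rescaled_bumpIntegral_le {n : ℕ} {u : EuclideanSpace ℝ (Fin (n+1)) → ℝ}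
    (hu : ContinuousOn u (closedHalfBall n)) {a b : EuclideanSpace ℝ (Fin (n+1))}
    (ha : ‖a‖ ≤ 1/4) (ha0 : 0 < a (Fin.last n)) (hlast : b (Fin.last n) = -a (Fin.last n)) {B : ℝ}
    (hB : ∀ s ∈ Set.Ioc (0 : ℝ) (1/2), |(s ^ (n + 5))⁻¹ * bumpIntegral u a b s| ≤ B) :
    (∫ x : EuclideanSpace ℝ (Fin (n+1)), paraboloid 1 0 x ^ 2) * |u a| ≤ B := by
  set c := ∫ x : EuclideanSpace ℝ (Fin (n+1)), paraboloid 1 0 x ^ 2 with hc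
  have hcpos : 0 < c := integral_paraboloid_sq_pos (n + 1)
  refine le_of_forall_pos_le_add fun ε hε => ?_
  have hcont : ContinuousAt u a := hu.continuousAt (Filter.mem_of_superset
    ((isOpen_openHalfBall n).mem_nhds ⟨by linarith, ha0⟩) (openHalfBall_subset n))
  obtain ⟨δ, hδ, hδu⟩ := Metric.continuousAt_iff.1 hcont (ε / c) (by positivity)
  obtain ⟨s, hs0, hs⟩ := exists_between
    (show 0 < min (min δ (1/2)) (a (Fin.last n)) by
      refine lt_min (lt_min hδ (by norm_num)) ha0)
  obtain ⟨hs1, hs3⟩ := lt_min_iff.1 hs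
  obtain ⟨hs1, hs2⟩ := lt_min_iff.1 hs1
  have hPa := continuous_paraboloid s a
  have hlastle : ∀ z : EuclideanSpace ℝ (Fin (n+1)), |z (Fin.last n)| ≤ ‖z‖ := fun z =>
    PiLp.norm_apply_le z _
  have hbump : bumpIntegral u a b s = ∫ x in Bplus 0 1, u x * paraboloid s a x ^ 2 := by
    refine setIntegral_congr_fun (measurableSet_Bplus n 1) fun x hx => ?_
    have hx0 := (mem_Bplus_zero.1 hx).1
    have hle := (le_abs_self _).trans (hlastle (x - b))
    simp only [PiLp.sub_apply, hlast] at hle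
    simp only [paraboloid_eq_zero (c := b) hs0.le (x := x) (by linarith)]
    ring
  have hfull : ∫ x in Bplus 0 1, paraboloid s a x ^ 2 = s ^ (n + 5) * c := by
    rw [setIntegral_eq_integral_of_forall_compl_eq_zero, integral_paraboloid_sq hs0]
    intro x hx
    rw [paraboloid_eq_zero hs0.le]
    · simp
    · by_contra hlt
      rw [not_le] at hlt
      refine hx (mem_Bplus_zero.2 ⟨?_, ?_⟩)
      · have := (neg_abs_le _).trans' (neg_le_neg (hlastle (x - a)))
        simp only [PiLp.sub_apply] at this
        linarith
      · have := norm_le_insert' x a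
        linarith
  have hdiff : |s ^ (n + 5) * c * u a - bumpIntegral u a b s| ≤ s ^ (n + 5) * ε := by
    have h1 : s ^ (n + 5) * c * u a - bumpIntegral u a b s =
        ∫ x in Bplus 0 1, (u a - u x) * paraboloid s a x ^ 2 := by
      rw [hbump, ← hfull, ← integral_mul_const, ← integral_sub]
      · congr 1; ext x; ring
      · exact ContinuousOn.integrableOn_Bplus (by fun_prop)
      · exact ContinuousOn.integrableOn_Bplus (by fun_prop)
    have h2 : s ^ (n + 5) * ε = ∫ x in Bplus 0 1, ε / c * paraboloid s a x ^ 2 := by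
      rw [integral_const_mul, hfull]; field_simp
    rw [h1, h2, ← Real.norm_eq_abs]
    refine norm_integral_le_of_norm_le (ContinuousOn.integrableOn_Bplus (by fun_prop))
      (Filter.Eventually.of_forall fun x => ?_)
    rw [norm_mul, Real.norm_eq_abs, Real.norm_eq_abs, abs_of_nonneg (sq_nonneg (paraboloid s a x))]
    by_cases hx : s ≤ ‖x - a‖
    · simp [paraboloid_eq_zero hs0.le hx]
    · refine mul_le_mul_of_nonneg_right ?_ (sq_nonneg _)
      have := hδu (x := x) (by rw [dist_eq_norm]; linarith)
      rw [Real.dist_eq, abs_sub_comm] at this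
      exact this.le
  have hBs := hB s ⟨hs0, hs2.le⟩
  have hspos : 0 < s ^ (n + 5) := by positivity
  rw [abs_mul, abs_of_pos (inv_pos.2 hspos), inv_mul_le_iff₀ hspos] at hBs
  have h3 := abs_sub_abs_le_abs_sub (s ^ (n + 5) * c * u a) (bumpIntegral u a b s)
  rw [abs_mul, abs_of_pos (by positivity)] at h3
  refine le_of_mul_le_mul_left ?_ hspos
  linarith

/-- De Giorgi–Nash–Moser-type boundary estimate on the unit half-ball, with
`g = ∂_{n+1}ũ(·, 0)`: for `p > n` there is `C = C(n, p) > 0` such that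
`‖ũ‖_{L^∞(B⁺_{1/4})} ≤ C (‖ũ‖_{L²(B⁺₁)} + ‖g‖_{Lᵖ(B'₁)})`. -/
theorem moser_boundary_estimate (n : ℕ) (hn : 1 ≤ n) (p : ℝ) (hp : (n : ℝ) < p) :
    ∃ C > (0 : ℝ), ∀ u : EuclideanSpace ℝ (Fin (n+1)) → ℝ,
      ContDiffOn ℝ 1 u {x | ‖x‖ ≤ 1 ∧ 0 ≤ x (Fin.last n)} →
      HarmonicOnSet u {x | ‖x‖ < 1 ∧ 0 < x (Fin.last n)} →
      ∀ x : EuclideanSpace ℝ (Fin (n+1)), 0 < x (Fin.last n) → ‖x‖ ≤ 1/4 →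
        |u x| ≤ C * (LpnormOn u 2 (Bplus 0 1) +
          LpnormOn (fun x' => fderivWithin ℝ u {y | ‖y‖ ≤ 1 ∧ 0 ≤ y (Fin.last n)} (emb x')
            (EuclideanSpace.single (Fin.last n) 1)) p (Bprime 0 1)) := by
  have hn1 : (1 : ℝ) ≤ n := by exact_mod_cast hn
  have hp0 : 0 < p := by linarith
  set c := ∫ x : EuclideanSpace ℝ (Fin (n+1)), paraboloid 1 0 x ^ 2
  have hc : 0 < c := integral_paraboloid_sq_pos (n + 1)
  set v := volume.real (Bplus (n := n) 0 1) ^ (1 - 1 / (2 : ℝ))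
  have hv : 0 ≤ v := Real.rpow_nonneg measureReal_nonneg _
  set w := volume.real (Metric.closedBall (0 : EuclideanSpace ℝ (Fin n)) 1) ^ (1 - 1 / p)
  have hw : 0 ≤ w := Real.rpow_nonneg measureReal_nonneg _
  set q := 1 - n / p with hq
  have hq0 : 0 < q := by rw [hq, sub_pos, div_lt_one hp0]; exact hp
  set C₁ := ((1 / 2 : ℝ) ^ (n + 5))⁻¹ * v
  set C₂ := w / q * (1 / 2 : ℝ) ^ q
  have hC₁ : 0 ≤ C₁ := by positivity
  have hC₂ : 0 ≤ C₂ := by positivity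
  refine ⟨(C₁ + C₂ + 1) / c, by positivity, fun u hu hharm a ha0 ha => ?_⟩
  change ContDiffOn ℝ 1 u (closedHalfBall n) at hu
  set g : EuclideanSpace ℝ (Fin n) → ℝ := fun x' => fderivWithin ℝ u
    {y | ‖y‖ ≤ 1 ∧ 0 ≤ y (Fin.last n)} (emb x') (EuclideanSpace.single (Fin.last n) 1) with hgdef
  have hg : ContinuousOn g (Bprime 0 1) := by
    have h := hu.continuousOn_fderivWithin (uniqueDiffOn_closedHalfBall n) le_rfl
    refine (h.comp (continuous_emb n).continuousOn fun x' hx' => ?_).clm_apply continuousOn_const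
    rw [Bprime_zero, mem_closedBall_zero_iff] at hx'
    exact ⟨by rwa [norm_emb], (emb_last x').ge⟩
  have hU0 : 0 ≤ LpnormOn u 2 (Bplus (n := n) 0 1) := Real.rpow_nonneg ENNReal.toReal_nonneg _
  have hG0 : 0 ≤ LpnormOn g p (Bprime 0 1) := Real.rpow_nonneg ENNReal.toReal_nonneg _
  set U := LpnormOn u 2 (Bplus (n := n) 0 1)
  set G := LpnormOn g p (Bprime 0 1)
  have hucont := hu.continuousOn
  have hhalf : |((1 / 2 : ℝ) ^ (n + 5))⁻¹ * bumpIntegral u a (flatReflect a) (1 / 2)| ≤ C₁ * U := by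
    obtain ⟨B, hB⟩ := (isCompact_closedHalfBall n).exists_bound_of_continuousOn hucont
    have hfin : volume (Bplus (n := n) 0 1) ≠ ⊤ := ne_top_of_le_ne_top
      (isCompact_closedHalfBall n).measure_lt_top.ne (measure_mono (Bplus_subset_closedHalfBall n))
    have h1 := setIntegral_abs_le_LpnormOn (f := u) (p := 2) (by norm_num) subset_rfl
      (measurableSet_Bplus n 1) hfin (hucont.integrableOn_Bplus).aestronglyMeasurable
      (fun x hx => hB x (Bplus_subset_closedHalfBall n hx))
    rw [abs_mul, abs_of_pos (by positivity), mul_assoc]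
    refine mul_le_mul_of_nonneg_left (le_trans ?_ h1) (by positivity)
    rw [← Real.norm_eq_abs]
    refine norm_integral_le_of_norm_le (hucont.abs.integrableOn_Bplus)
      (Filter.Eventually.of_forall fun x => ?_)
    rw [norm_mul, Real.norm_eq_abs, Real.norm_eq_abs]
    refine mul_le_of_le_one_right (abs_nonneg _) ?_
    have h2 := paraboloid_nonneg (1 / 2) a x
    have h3 := paraboloid_nonneg (1 / 2) (flatReflect a) x
    have h4 := paraboloid_le (1 / 2) a x
    have h5 := paraboloid_le (1 / 2) (flatReflect a) x
    rw [abs_of_nonneg (by positivity)]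
    nlinarith
  have hderiv : ∀ s ∈ Set.Ioc (0 : ℝ) (1 / 2),
      |(6 * s ^ (n + 6))⁻¹ * ∫ x' in Bprime (n := n) 0 1, 2 * paraboloid s a (emb x') ^ 3 * g x'| ≤
        (w * G) * s ^ (q - 1) := fun s hs => by
    have hs0 := hs.1
    have h1 := abs_boundary_integral_le hn hp hg ha hs
    rw [abs_mul, abs_of_pos (by positivity), inv_mul_le_iff₀ (by positivity)]
    refine h1.trans ?_
    have hpow : s ^ (n - n / p) = s ^ n * s ^ (q - 1) := by
      rw [← Real.rpow_natCast, ← Real.rpow_add hs0]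
      congr 1
      rw [hq]; ring
    rw [hpow, pow_add]
    have h2 : 0 ≤ s ^ 6 * s ^ n * s ^ (q - 1) * w * G := by positivity
    calc _ = 2 * (s ^ 6 * s ^ n * s ^ (q - 1) * w * G) := by ring
      _ ≤ 6 * (s ^ 6 * s ^ n * s ^ (q - 1) * w * G) := by linarith
      _ = _ := by ring
  have hfinal := abs_mul_le_of_rescaled_bumpIntegral_le hucont ha ha0 (flatReflect_last a)
    (B := C₁ * U + C₂ * G) fun s hs => by
      refine (abs_le_of_deriv_le_rpow (mul_nonneg hw hG0) hq0
        (fun t ht => hasDerivAt_rescaled_bumpIntegral hu hharm ha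
          ((norm_flatReflect a).trans_le ha) (flatReflect_last a)
          (norm_emb_sub_flatReflect a) ht) hderiv hs).trans ?_
      refine add_le_add hhalf (le_of_eq ?_)
      ring
  rw [div_mul_eq_mul_div, le_div_iff₀ hc, mul_comm]
  refine hfinal.trans ?_
  nlinarith [mul_nonneg hC₁ hG0, mul_nonneg hC₂ hU0]
end

section
/- Let n ≥ 1, p > n, and λ, Λ > 0. Let ũ be continuously differentiable on the closed upper half-space {x ∈ ℝ^{n+1} : x_{n+1} ≥ 0} and harmonic on the open upper half-space ℝ^{n+1}_+, and set u(x') := ũ(x', 0) and g(x') := ∂_{n+1}ũ(x', 0) for x' ∈ ℝⁿ. Assume that: (i) |u(x')| ≤ Λ e^{−λ|x'|} for all x' ∈ ℝⁿ; (ii) ‖ũ(·, t)‖_{L²(ℝⁿ)} ≤ Λ for every t > 0; and (iii) ∫_{ℝⁿ} e^{λ|x'|/2} (|g(x')|² + |g(x')|ᵖ) dx' ≤ Λ. Then there exist constants C > 0 and c > 0, depending only on n, p, λ and Λ, such that |ũ(x)| ≤ C e^{−c|x|} for all x ∈ ℝ^{n+1}_+. -/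
open MeasureTheory

section HalfSpace

open Filter Topology Set FourierTransform
open scoped ContDiff

lemma embt_last {n : ℕ} (x : EuclideanSpace ℝ (Fin n)) (t : ℝ) : embt x t (Fin.last n) = t := by
  simp [embt]

lemma embt_castSucc {n : ℕ} (x : EuclideanSpace ℝ (Fin n)) (t : ℝ) (i : Fin n) :
    embt x t i.castSucc = x i := by
  simp [embt]

/-- The inclusion `x' ↦ (x', 0)` as a continuous linear map. -/
noncomputable def embL (n : ℕ) : EuclideanSpace ℝ (Fin n) →L[ℝ] EuclideanSpace ℝ (Fin (n+1)) :=
  LinearMap.toContinuousLinearMap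
    { toFun := emb
      map_add' := fun x y => by
        ext i
        refine Fin.lastCases ?_ (fun i => ?_) i <;> simp [emb]
      map_smul' := fun c x => by
        ext i
        refine Fin.lastCases ?_ (fun i => ?_) i <;> simp [emb] }

lemma embL_apply {n : ℕ} (x : EuclideanSpace ℝ (Fin n)) : embL n x = emb x := rfl

lemma embt_eq {n : ℕ} (x : EuclideanSpace ℝ (Fin n)) (t : ℝ) :
    embt x t = embL n x + t • EuclideanSpace.single (Fin.last n) 1 := by
  ext i
  refine Fin.lastCases ?_ (fun i => ?_) i
  · simp [embt_last, embL_apply, emb]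
  · simp [embt_castSucc, embL_apply, emb]

lemma exists_embt_eq {n : ℕ} (x : EuclideanSpace ℝ (Fin (n+1))) :
    ∃ x' : EuclideanSpace ℝ (Fin n), embt x' (x (Fin.last n)) = x := by
  refine ⟨WithLp.toLp 2 (fun i => x i.castSucc), ?_⟩
  ext i
  refine Fin.lastCases ?_ (fun i => ?_) i
  · simp [embt_last]
  · simp [embt_castSucc]

lemma embL_single {n : ℕ} (j : Fin n) :
    embL n (EuclideanSpace.single j 1) = EuclideanSpace.single j.castSucc (1:ℝ) := by
  ext i
  refine Fin.lastCases ?_ (fun i => ?_) i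
  · simp [embL_apply, emb]
  · simp [embL_apply, emb, Pi.single_apply]

lemma continuous_embt {n : ℕ} :
    Continuous fun p : ℝ × EuclideanSpace ℝ (Fin n) => embt p.2 p.1 := by
  simp only [embt_eq]
  fun_prop

/-- The closed upper half-space. -/
def closedHalf (n : ℕ) : Set (EuclideanSpace ℝ (Fin (n+1))) := {x | 0 ≤ x (Fin.last n)}

/-- The open upper half-space. -/
def openHalf (n : ℕ) : Set (EuclideanSpace ℝ (Fin (n+1))) := {x | 0 < x (Fin.last n)}

lemma isOpen_openHalf (n : ℕ) : IsOpen (openHalf n) :=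
  isOpen_lt continuous_const (by fun_prop)

lemma openHalf_subset (n : ℕ) : openHalf n ⊆ closedHalf n :=
  fun x (hx : 0 < x (Fin.last n)) => hx.le

lemma uniqueDiffOn_closedHalf (n : ℕ) : UniqueDiffOn ℝ (closedHalf n) := by
  apply uniqueDiffOn_convex
  · have : closedHalf n = (EuclideanSpace.proj (Fin.last n) :
      EuclideanSpace ℝ (Fin (n+1)) →L[ℝ] ℝ) ⁻¹' Ici 0 := by
      ext; simp [closedHalf]
    rw [this]
    exact (convex_Ici 0).linear_preimage _
  · refine ⟨EuclideanSpace.single (Fin.last n) 1, ?_⟩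
    exact interior_maximal (openHalf_subset n) (isOpen_openHalf n) (by simp [openHalf])

/-- Normal derivative, extended constantly below the boundary. -/
noncomputable def dt {n : ℕ} (u : EuclideanSpace ℝ (Fin (n+1)) → ℝ) (t : ℝ)
    (x : EuclideanSpace ℝ (Fin n)) : ℝ :=
  fderivWithin ℝ u (closedHalf n) (embt x (max t 0)) (EuclideanSpace.single (Fin.last n) 1)

/-- The restriction of `u` to height `max t 0`. -/
noncomputable def slice {n : ℕ} (u : EuclideanSpace ℝ (Fin (n+1)) → ℝ) (t : ℝ)
    (x : EuclideanSpace ℝ (Fin n)) : ℝ := u (embt x (max t 0))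

lemma continuous_embt_max {n : ℕ} :
    Continuous fun p : ℝ × EuclideanSpace ℝ (Fin n) => embt p.2 (max p.1 0) :=
  continuous_embt.comp (by fun_prop : Continuous fun p : ℝ × EuclideanSpace ℝ (Fin n) =>
    (max p.1 0, p.2))

section
variable {n : ℕ} {u : EuclideanSpace ℝ (Fin (n+1)) → ℝ}

lemma continuous_slice (hu : ContDiffOn ℝ 1 u (closedHalf n)) :
    Continuous fun p : ℝ × EuclideanSpace ℝ (Fin n) => slice u p.1 p.2 :=
  hu.continuousOn.comp_continuous continuous_embt_max (fun p => by simp [closedHalf, embt_last])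

lemma continuous_dt (hu : ContDiffOn ℝ 1 u (closedHalf n)) :
    Continuous fun p : ℝ × EuclideanSpace ℝ (Fin n) => dt u p.1 p.2 := by
  have h := hu.continuousOn_fderivWithin (uniqueDiffOn_closedHalf n) le_rfl
  have := h.comp_continuous continuous_embt_max (fun p => by simp [closedHalf, embt_last])
  exact this.clm_apply continuous_const

lemma embt_mem {t : ℝ} (ht : 0 < t) (x : EuclideanSpace ℝ (Fin n)) : embt x t ∈ openHalf n := by
  simpa [openHalf, embt_last] using ht

lemma hasDerivAt_embt (t : ℝ) (x : EuclideanSpace ℝ (Fin n)) :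
    HasDerivAt (fun s => embt x s) (EuclideanSpace.single (Fin.last n) 1) t := by
  simp only [embt_eq]
  simpa using ((hasDerivAt_id t).smul_const
    (EuclideanSpace.single (Fin.last n) (1:ℝ))).const_add (embL n x)

lemma hasFDerivAt_embt (t : ℝ) (x : EuclideanSpace ℝ (Fin n)) :
    HasFDerivAt (fun y => embt y t) (embL n) x := by
  simp only [embt_eq]
  exact (embL n).hasFDerivAt.add_const _

lemma dt_eq {t : ℝ} (ht : 0 < t) (x : EuclideanSpace ℝ (Fin n)) :
    dt u t x = fderiv ℝ u (embt x t) (EuclideanSpace.single (Fin.last n) 1) := by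
  unfold dt
  rw [max_eq_left ht.le, fderivWithin_of_mem_nhds]
  exact mem_of_superset ((isOpen_openHalf n).mem_nhds (embt_mem ht x)) (openHalf_subset n)

lemma slice_eq {t : ℝ} (ht : 0 < t) (x : EuclideanSpace ℝ (Fin n)) :
    slice u t x = u (embt x t) := by
  simp [slice, max_eq_left ht.le]

noncomputable def dtt (u : EuclideanSpace ℝ (Fin (n+1)) → ℝ) (t : ℝ)
    (x : EuclideanSpace ℝ (Fin n)) : ℝ :=
  fderiv ℝ (fun y => fderiv ℝ u y (EuclideanSpace.single (Fin.last n) 1)) (embt x t)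
    (EuclideanSpace.single (Fin.last n) 1)

lemma contDiffOn_fderiv_apply (hu : ContDiffOn ℝ 2 u (openHalf n))
    (v : EuclideanSpace ℝ (Fin (n+1))) :
    ContDiffOn ℝ 1 (fun y => fderiv ℝ u y v) (openHalf n) :=
  (hu.fderiv_of_isOpen (isOpen_openHalf n) (by norm_num)).clm_apply contDiffOn_const

lemma hasDerivAt_slice (hu : ContDiffOn ℝ 2 u (openHalf n)) {t : ℝ} (ht : 0 < t)
    (x : EuclideanSpace ℝ (Fin n)) :
    HasDerivAt (fun s => slice u s x) (dt u t x) t := by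
  have h1 : HasFDerivAt u (fderiv ℝ u (embt x t)) (embt x t) :=
    ((hu.contDiffAt ((isOpen_openHalf n).mem_nhds (embt_mem ht x))).differentiableAt
      (by norm_num)).hasFDerivAt
  rw [dt_eq ht]
  refine (h1.comp_hasDerivAt t (hasDerivAt_embt t x)).congr_of_eventuallyEq ?_
  filter_upwards [lt_mem_nhds ht] with s hs using slice_eq hs x

lemma hasDerivAt_dt (hu : ContDiffOn ℝ 2 u (openHalf n)) {t : ℝ} (ht : 0 < t)
    (x : EuclideanSpace ℝ (Fin n)) :
    HasDerivAt (fun s => dt u s x) (dtt u t x) t := by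
  have h1 := (((contDiffOn_fderiv_apply hu (EuclideanSpace.single (Fin.last n) 1)).contDiffAt
    ((isOpen_openHalf n).mem_nhds (embt_mem ht x))).differentiableAt (by norm_num)).hasFDerivAt
  refine (h1.comp_hasDerivAt t (hasDerivAt_embt t x)).congr_of_eventuallyEq ?_
  filter_upwards [lt_mem_nhds ht] with s hs using dt_eq hs x

lemma continuousOn_dtt (hu : ContDiffOn ℝ 2 u (openHalf n)) :
    ContinuousOn (fun p : ℝ × EuclideanSpace ℝ (Fin n) => dtt u p.1 p.2) {p | 0 < p.1} := by
  have h1 := ((contDiffOn_fderiv_apply hu (EuclideanSpace.single (Fin.last n) 1)).fderiv_of_isOpen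
    (isOpen_openHalf n) (m := 0) (by norm_num)).continuousOn
  have h2 := h1.comp (continuous_embt (n := n)).continuousOn (s := {p | 0 < p.1})
    (fun p hp => embt_mem hp p.2)
  exact h2.clm_apply continuousOn_const

lemma contDiff_slice (hu : ContDiffOn ℝ 2 u (openHalf n)) {t : ℝ} (ht : 0 < t) :
    ContDiff ℝ 2 (slice u t) := by
  have : slice u t = fun x => u (embt x t) := funext fun x => slice_eq ht x
  rw [this, ← contDiffOn_univ]
  refine hu.comp ?_ (fun x _ => embt_mem ht x)
  simp only [embt_eq]
  fun_prop

lemma fderiv_slice (hu : ContDiffOn ℝ 2 u (openHalf n)) {t : ℝ} (ht : 0 < t)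
    (x : EuclideanSpace ℝ (Fin n)) (j : Fin n) :
    fderiv ℝ (slice u t) x (EuclideanSpace.single j 1) =
      fderiv ℝ u (embt x t) (EuclideanSpace.single j.castSucc 1) := by
  have : slice u t = fun x => u (embt x t) := funext fun x => slice_eq ht x
  have h1 : HasFDerivAt u (fderiv ℝ u (embt x t)) (embt x t) :=
    ((hu.contDiffAt ((isOpen_openHalf n).mem_nhds (embt_mem ht x))).differentiableAt
      (by norm_num)).hasFDerivAt
  have h2 := (h1.comp x (hasFDerivAt_embt t x)).fderiv
  simp only [Function.comp_def] at h2
  rw [this, h2]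
  simp [embL_single]

lemma dtt_eq_neg_lapl_slice (hu : HarmonicOnSet u (openHalf n)) {t : ℝ} (ht : 0 < t)
    (x : EuclideanSpace ℝ (Fin n)) :
    dtt u t x = - lapl (slice u t) x := by
  have h0 := hu.2 _ (embt_mem ht x)
  rw [lapl, Fin.sum_univ_castSucc] at h0
  rw [dtt, eq_neg_iff_add_eq_zero, lapl, add_comm, ← h0]
  congr 1
  refine Finset.sum_congr rfl fun j _ => ?_
  simp only [fderiv_slice hu.1 ht]
  have h1 := (((contDiffOn_fderiv_apply hu.1 (EuclideanSpace.single j.castSucc 1)).contDiffAt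
    ((isOpen_openHalf n).mem_nhds (embt_mem ht x))).differentiableAt (by norm_num)).hasFDerivAt
  have h2 := (h1.comp x (hasFDerivAt_embt t x)).fderiv
  simp only [Function.comp_def] at h2
  rw [h2]
  simp [embL_single]

end

/-- The coordinate Laplacian of a complex-valued function. -/
noncomputable def laplC {n : ℕ} (ψ : EuclideanSpace ℝ (Fin n) → ℂ)
    (x : EuclideanSpace ℝ (Fin n)) : ℂ :=
  ∑ j : Fin n, fderiv ℝ (fun y => fderiv ℝ ψ y (EuclideanSpace.single j 1)) x
    (EuclideanSpace.single j 1)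

lemma integrable_smul_of_compact {n : ℕ} {f : EuclideanSpace ℝ (Fin n) → ℝ}
    {ψ : EuclideanSpace ℝ (Fin n) → ℂ} (hf : Continuous f) (hψ : Continuous ψ)
    (hc : HasCompactSupport ψ) : Integrable fun x => f x • ψ x :=
  (hf.smul hψ).integrable_of_hasCompactSupport hc.smul_left

lemma integral_fderiv_smul {n : ℕ} {f : EuclideanSpace ℝ (Fin n) → ℝ}
    {ψ : EuclideanSpace ℝ (Fin n) → ℂ} (hf : ContDiff ℝ 1 f) (hψ : ContDiff ℝ 1 ψ)
    (hc : HasCompactSupport ψ) (v : EuclideanSpace ℝ (Fin n)) :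
    ∫ x, fderiv ℝ f x v • ψ x = -∫ x, f x • fderiv ℝ ψ x v := by
  have h1 : Continuous fun x => fderiv ℝ f x v :=
    (hf.continuous_fderiv (by norm_num)).clm_apply continuous_const
  have h2 : Continuous fun x => fderiv ℝ ψ x v :=
    (hψ.continuous_fderiv (by norm_num)).clm_apply continuous_const
  have h3 : HasCompactSupport fun x => fderiv ℝ ψ x v := hc.fderiv_apply (𝕜 := ℝ) v
  rw [integral_smul_fderiv_eq_neg_fderiv_smul_of_integrable
    (integrable_smul_of_compact h1 hψ.continuous hc)
    (integrable_smul_of_compact hf.continuous h2 h3)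
    (integrable_smul_of_compact hf.continuous hψ.continuous hc)
    (fun x _ => hf.differentiable (by norm_num) x)
    (fun x _ => hψ.differentiable (by norm_num) x), neg_neg]

lemma contDiff_fderiv_apply {n : ℕ} {F : Type*} [NormedAddCommGroup F] [NormedSpace ℝ F]
    {f : EuclideanSpace ℝ (Fin n) → F} (hf : ContDiff ℝ 2 f) (v : EuclideanSpace ℝ (Fin n)) :
    ContDiff ℝ 1 fun x => fderiv ℝ f x v :=
  (hf.fderiv_right (m := 1) (by norm_num)).clm_apply contDiff_const

lemma integral_lapl_smul {n : ℕ} {f : EuclideanSpace ℝ (Fin n) → ℝ}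
    {ψ : EuclideanSpace ℝ (Fin n) → ℂ} (hf : ContDiff ℝ 2 f) (hψ : ContDiff ℝ 2 ψ)
    (hc : HasCompactSupport ψ) :
    ∫ x, lapl f x • ψ x = ∫ x, f x • laplC ψ x := by
  simp only [lapl, laplC, Finset.sum_smul, Finset.smul_sum]
  have hf1 := fun j : Fin n => contDiff_fderiv_apply hf (EuclideanSpace.single j 1)
  have hψ1 := fun j : Fin n => contDiff_fderiv_apply hψ (EuclideanSpace.single j 1)
  have hc1 := fun j : Fin n => hc.fderiv_apply (𝕜 := ℝ) (EuclideanSpace.single j 1)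
  rw [integral_finsetSum, integral_finsetSum]
  · refine Finset.sum_congr rfl fun j _ => ?_
    rw [integral_fderiv_smul (hf1 j) (hψ.of_le (by norm_num)) hc,
      integral_fderiv_smul (hf.of_le (by norm_num)) (hψ1 j) (hc1 j), neg_neg]
  · intro j _
    exact integrable_smul_of_compact hf.continuous
      (((hψ1 j).continuous_fderiv (by norm_num)).clm_apply continuous_const)
      ((hc1 j).fderiv_apply (𝕜 := ℝ) _)
  · intro j _
    exact integrable_smul_of_compact
      (((hf1 j).continuous_fderiv (by norm_num)).clm_apply continuous_const) hψ.continuous hc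

lemma hasDerivAt_integral_smul {n : ℕ} {f f' : ℝ → EuclideanSpace ℝ (Fin n) → ℝ}
    {ψ : EuclideanSpace ℝ (Fin n) → ℂ} (hψ : Continuous ψ) (hc : HasCompactSupport ψ)
    (hf : ∀ s, Continuous (f s))
    (hf' : ContinuousOn (fun p : ℝ × EuclideanSpace ℝ (Fin n) => f' p.1 p.2) {p | 0 < p.1})
    (hd : ∀ s, 0 < s → ∀ x, HasDerivAt (fun s => f s x) (f' s x) s) {t : ℝ} (ht : 0 < t) :
    HasDerivAt (fun s => ∫ x, f s x • ψ x) (∫ x, f' t x • ψ x) t := by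
  have hcont : ∀ s, 0 < s → Continuous (f' s) := fun s hs =>
    hf'.comp_continuous (by fun_prop : Continuous fun x : EuclideanSpace ℝ (Fin n) => (s, x))
      (fun _ => hs)
  have hK : IsCompact (Icc (t/2) (2*t) ×ˢ tsupport ψ) := isCompact_Icc.prod hc
  obtain ⟨M, hM⟩ := hK.exists_bound_of_continuousOn (hf'.mono fun p hp => by
    have := hp.1.1
    show 0 < p.1
    linarith)
  refine (hasDerivAt_integral_of_dominated_loc_of_deriv_le (bound := fun x => M * ‖ψ x‖)
    (s := Ioo (t/2) (2*t)) (F := fun s x => f s x • ψ x) (F' := fun s x => f' s x • ψ x)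
    (Ioo_mem_nhds (by linarith) (by linarith)) ?_ ?_ ?_ ?_ ?_ ?_).2
  · exact Eventually.of_forall fun s => ((hf s).smul hψ).aestronglyMeasurable
  · exact integrable_smul_of_compact (hf t) hψ hc
  · exact ((hcont t ht).smul hψ).aestronglyMeasurable
  · refine Eventually.of_forall fun x s hs => ?_
    rw [norm_smul]
    by_cases hx : x ∈ tsupport ψ
    · exact mul_le_mul_of_nonneg_right (hM (s, x) ⟨Ioo_subset_Icc_self hs, hx⟩) (norm_nonneg _)
    · simp [image_eq_zero_of_notMem_tsupport hx]
  · exact ((hψ.integrable_of_hasCompactSupport hc).norm).const_mul M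
  · refine Eventually.of_forall fun x s hs => ?_
    exact (hd s (by linarith [hs.1]) x).smul_const (ψ x)

lemma continuous_integral_smul {n : ℕ} {f : ℝ → EuclideanSpace ℝ (Fin n) → ℝ}
    {ψ : EuclideanSpace ℝ (Fin n) → ℂ} (hψ : Continuous ψ) (hc : HasCompactSupport ψ)
    (hf : Continuous fun p : ℝ × EuclideanSpace ℝ (Fin n) => f p.1 p.2) :
    Continuous fun t => ∫ x, f t x • ψ x := by
  have h : ∀ t, ∫ x, f t x • ψ x = ∫ x in tsupport ψ, f t x • ψ x := fun t => by
    rw [setIntegral_eq_integral_of_forall_compl_eq_zero]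
    intro x hx
    simp [image_eq_zero_of_notMem_tsupport hx]
  simp only [h]
  refine continuous_parametric_integral_of_continuous (f := fun t x => f t x • ψ x) ?_ hc
  exact hf.smul (hψ.comp continuous_snd)

lemma continuous_laplC {n : ℕ} {ψ : EuclideanSpace ℝ (Fin n) → ℂ} (hψ : ContDiff ℝ 2 ψ) :
    Continuous (laplC ψ) :=
  continuous_finsetSum _ fun j _ =>
    ((contDiff_fderiv_apply hψ _).continuous_fderiv (by norm_num)).clm_apply continuous_const

lemma laplC_eq_zero {n : ℕ} {ψ : EuclideanSpace ℝ (Fin n) → ℂ} {x : EuclideanSpace ℝ (Fin n)}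
    (hx : x ∉ tsupport ψ) : laplC ψ x = 0 := by
  refine Finset.sum_eq_zero fun j _ => ?_
  have h1 := tsupport_fderiv_apply_subset ℝ (f := ψ) (EuclideanSpace.single j 1)
  have h2 := tsupport_fderiv_apply_subset ℝ
    (f := fun y => fderiv ℝ ψ y (EuclideanSpace.single j 1)) (EuclideanSpace.single j 1)
  exact image_eq_zero_of_notMem_tsupport (f := fun x => fderiv ℝ (fun y =>
    fderiv ℝ ψ y (EuclideanSpace.single j 1)) x (EuclideanSpace.single j 1))
    fun h => hx (h1 (h2 h))

lemma hasCompactSupport_laplC {n : ℕ} {ψ : EuclideanSpace ℝ (Fin n) → ℂ}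
    (hc : HasCompactSupport ψ) : HasCompactSupport (laplC ψ) :=
  HasCompactSupport.intro hc fun _ hx => laplC_eq_zero hx

/-- Green's identity on the slab of height `T`, tested against
`ψ(x') sinh (a (T - t))`. -/
lemma green_slab {n : ℕ} {u : EuclideanSpace ℝ (Fin (n+1)) → ℝ}
    (hu1 : ContDiffOn ℝ 1 u (closedHalf n)) (hu : HarmonicOnSet u (openHalf n))
    {ψ : EuclideanSpace ℝ (Fin n) → ℂ} (hψ : ContDiff ℝ 2 ψ) (hc : HasCompactSupport ψ)
    (a : ℝ) {T : ℝ} (hT : 0 < T) :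
    (a : ℂ) * ∫ x, slice u T x • ψ x =
      (a * Real.cosh (a * T) : ℝ) * (∫ x, slice u 0 x • ψ x)
      + (Real.sinh (a * T) : ℝ) * (∫ x, dt u 0 x • ψ x)
      - ∫ t in (0:ℝ)..T, (Real.sinh (a * (T - t)) : ℂ) *
          ∫ x, slice u t x • ((a:ℂ)^2 * ψ x + laplC ψ x) := by
  have hlc := continuous_laplC hψ
  have hlcs := hasCompactSupport_laplC hc
  have hcs := continuous_slice hu1
  have hcd := continuous_dt hu1
  have hs : ∀ t, Continuous (slice u t) := fun t =>
    hcs.comp (by fun_prop : Continuous fun x : EuclideanSpace ℝ (Fin n) => (t, x))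
  have hdd : ∀ t, Continuous (dt u t) := fun t =>
    hcd.comp (by fun_prop : Continuous fun x : EuclideanSpace ℝ (Fin n) => (t, x))
  set W : ℝ → ℂ := fun t => ∫ x, slice u t x • ψ x with hW
  set D : ℝ → ℂ := fun t => ∫ x, dt u t x • ψ x with hD
  have hWc : Continuous W := continuous_integral_smul hψ.continuous hc hcs
  have hDc : Continuous D := continuous_integral_smul hψ.continuous hc hcd
  have hW' : ∀ t, 0 < t → HasDerivAt W (D t) t := fun t ht =>
    hasDerivAt_integral_smul hψ.continuous hc hs hcd.continuousOn
      (fun s hs x => hasDerivAt_slice hu.1 hs x) ht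
  have hD' : ∀ t, 0 < t → HasDerivAt D (-∫ x, slice u t x • laplC ψ x) t := fun t ht => by
    have := hasDerivAt_integral_smul hψ.continuous hc hdd (continuousOn_dtt hu.1)
      (fun s hs x => hasDerivAt_dt hu.1 hs x) ht
    convert! this using 1
    rw [← integral_lapl_smul (contDiff_slice hu.1 ht) hψ hc, ← integral_neg]
    simp only [dtt_eq_neg_lapl_slice hu ht, neg_smul]
  have hG : ∀ t, ∫ x, slice u t x • ((a:ℂ)^2 * ψ x + laplC ψ x)
      = (a:ℂ)^2 * W t + ∫ x, slice u t x • laplC ψ x := fun t => by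
    rw [hW, ← integral_const_mul, ← integral_add]
    · congr 1; ext x; rw [smul_add, mul_smul_comm]
    · exact (integrable_smul_of_compact (hs t) hψ.continuous hc).const_mul _
    · exact integrable_smul_of_compact (hs t) hlc hlcs
  simp only [hG]
  have hS : ∀ t, HasDerivAt (fun t => ((Real.sinh (a * (T - t)) : ℝ) : ℂ))
      ((-a * Real.cosh (a * (T - t)) : ℝ) : ℂ) t := fun t => by
    apply HasDerivAt.ofReal_comp
    have h1 : HasDerivAt (fun t => a * (T - t)) (-a) t := by
      simpa using ((hasDerivAt_id t).const_sub T).const_mul a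
    convert! h1.sinh using 1; ring
  have hC : ∀ t, HasDerivAt (fun t => ((-a * Real.cosh (a * (T - t)) : ℝ) : ℂ))
      ((a ^ 2 * Real.sinh (a * (T - t)) : ℝ) : ℂ) t := fun t => by
    apply HasDerivAt.ofReal_comp
    have h1 : HasDerivAt (fun t => a * (T - t)) (-a) t := by
      simpa using ((hasDerivAt_id t).const_sub T).const_mul a
    convert! h1.cosh.const_mul (-a) using 1; ring
  have hlW : Continuous fun t => ∫ x, slice u t x • laplC ψ x :=
    continuous_integral_smul hlc hlcs hcs
  have hFTC := intervalIntegral.integral_eq_sub_of_hasDerivAt_of_le hT.le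
    (f := fun t => W t * ((-a * Real.cosh (a * (T - t)) : ℝ) : ℂ)
      - D t * ((Real.sinh (a * (T - t)) : ℝ) : ℂ))
    (f' := fun t => ((Real.sinh (a * (T - t)) : ℝ) : ℂ) *
      ((a:ℂ)^2 * W t + ∫ x, slice u t x • laplC ψ x))
    (by
      refine Continuous.continuousOn ?_
      refine (hWc.mul ?_).sub (hDc.mul ?_) <;> fun_prop)
    (fun t ht => by
      convert! ((hW' t ht.1).mul (hC t)).sub ((hD' t ht.1).mul (hS t)) using 1
      push_cast; ring)
    (by
      refine Continuous.intervalIntegrable ?_ _ _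
      refine Continuous.mul (by fun_prop) ((hWc.const_mul _).add hlW))
  rw [hFTC]
  simp only [sub_self, mul_zero, Real.cosh_zero, Real.sinh_zero, sub_zero]
  push_cast
  ring

/-- The kernel of the Fourier transform. -/
noncomputable def chi {n : ℕ} (ξ x : EuclideanSpace ℝ (Fin n)) : ℂ :=
  Complex.exp (((-2 * Real.pi * inner ℝ ξ x : ℝ) : ℂ) * Complex.I)

lemma contDiff_chi {n : ℕ} (ξ : EuclideanSpace ℝ (Fin n)) {k : WithTop ℕ∞} :
    ContDiff ℝ k (chi ξ) := by
  unfold chi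
  refine ContDiff.cexp (ContDiff.mul ?_ contDiff_const)
  exact Complex.ofRealCLM.contDiff.comp
    (contDiff_const.mul (contDiff_const.inner ℝ contDiff_id))

lemma chi_comm {n : ℕ} (ξ x : EuclideanSpace ℝ (Fin n)) : chi ξ x = chi x ξ := by
  simp [chi, real_inner_comm]

lemma continuous_chi {n : ℕ} :
    Continuous fun p : EuclideanSpace ℝ (Fin n) × EuclideanSpace ℝ (Fin n) => chi p.1 p.2 := by
  unfold chi
  fun_prop

lemma fourier_eq_chi {n : ℕ} (f : EuclideanSpace ℝ (Fin n) → ℂ) (w : EuclideanSpace ℝ (Fin n)) :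
    𝓕 f w = ∫ v, chi v w * f v := by
  simp only [Real.fourier_eq', chi, smul_eq_mul]

lemma continuous_fourier_of_integrable {n : ℕ} {f : EuclideanSpace ℝ (Fin n) → ℂ}
    (hf : Integrable f) : Continuous (𝓕 f) :=
  VectorFourier.fourierIntegral_continuous Real.continuous_fourierChar
    (by exact continuous_inner) hf

lemma integral_fourier_mul {n : ℕ} {f g : EuclideanSpace ℝ (Fin n) → ℂ}
    (hf : Integrable f) (hg : Integrable g) :
    ∫ ξ, 𝓕 f ξ * g ξ = ∫ x, f x * 𝓕 g x := by
  have := VectorFourier.integral_fourierIntegral_smul_eq_flip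
    (L := innerₗ (EuclideanSpace ℝ (Fin n))) Real.continuous_fourierChar continuous_inner hf hg
  rw [flip_innerₗ] at this
  exact this

lemma plancherel_of_contDiff {n : ℕ} {f : EuclideanSpace ℝ (Fin n) → ℂ}
    (hf : ContDiff ℝ ∞ f) (hc : HasCompactSupport f) :
    Integrable (fun x => ‖𝓕 f x‖ ^ 2) ∧ ∫ x, ‖𝓕 f x‖ ^ 2 = ∫ x, ‖f x‖ ^ 2 := by
  have h := (hc.toSchwartzMap hf).integral_norm_sq_fourier
  have h2 := (𝓕 (hc.toSchwartzMap hf)).memLp 2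
  have h3 : (⇑(hc.toSchwartzMap hf)) = f := rfl
  rw [SchwartzMap.fourier_coe, h3] at h h2
  exact ⟨h2.norm.integrable_sq, h⟩

lemma fderiv_mul_chi {n : ℕ} {f : EuclideanSpace ℝ (Fin n) → ℂ}
    {ξ x : EuclideanSpace ℝ (Fin n)} (hf : DifferentiableAt ℝ f x)
    (j : Fin n) :
    fderiv ℝ (fun y => f y * chi ξ y) x (EuclideanSpace.single j 1) =
      (fderiv ℝ f x (EuclideanSpace.single j 1) - 2 * Real.pi * Complex.I * ξ j * f x)
        * chi ξ x := by
  have h1 : HasFDerivAt (fun y : EuclideanSpace ℝ (Fin n) =>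
      ((-2 * Real.pi * inner ℝ ξ y : ℝ) : ℂ) * Complex.I)
      (Complex.I • (Complex.ofRealCLM.comp ((-2 * Real.pi) • innerSL ℝ ξ))) x := by
    have h2 : HasFDerivAt (fun y : EuclideanSpace ℝ (Fin n) => -2 * Real.pi * inner ℝ ξ y)
      ((-2 * Real.pi) • innerSL ℝ ξ) x := ((innerSL ℝ ξ).hasFDerivAt).const_mul _
    exact (Complex.ofRealCLM.hasFDerivAt.comp x h2).mul_const Complex.I
  have h3 := hf.hasFDerivAt.mul h1.cexp
  have h4 : HasFDerivAt (fun y => f y * chi ξ y) _ x := h3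
  rw [h4.fderiv]
  simp [chi, EuclideanSpace.inner_single_right]
  ring

lemma fderiv_comp_smul_ofReal {n : ℕ} {b : EuclideanSpace ℝ (Fin n) → ℝ}
    (hb : Differentiable ℝ b) (c r : ℝ) (x v : EuclideanSpace ℝ (Fin n)) :
    fderiv ℝ (fun y => ((c * b (r • y) : ℝ) : ℂ)) x v =
      ((c * r * fderiv ℝ b (r • x) v : ℝ) : ℂ) := by
  have h1 : HasFDerivAt (fun y : EuclideanSpace ℝ (Fin n) => r • y)
      (r • ContinuousLinearMap.id ℝ _) x := (hasFDerivAt_id x).const_smul r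
  have h2 := Complex.ofRealCLM.hasFDerivAt.comp x (((hb (r • x)).hasFDerivAt.comp x h1).const_mul c)
  have h3 : HasFDerivAt (fun y => ((c * b (r • y) : ℝ) : ℂ)) _ x := h2
  rw [h3.fderiv]
  simp
  ring

lemma laplC_cutoff_mul_chi {n : ℕ} {b : EuclideanSpace ℝ (Fin n) → ℝ}
    (hb : ContDiff ℝ 2 b) (r : ℝ) (ξ x : EuclideanSpace ℝ (Fin n)) :
    ((2 * Real.pi * ‖ξ‖ : ℝ) : ℂ) ^ 2 * (b (r • x) * chi ξ x) +
      laplC (fun y => (b (r • y) : ℂ) * chi ξ y) x =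
    ((r ^ 2 * lapl b (r • x) : ℝ) - ∑ j, 4 * Real.pi * Complex.I * r * ξ j *
      (fderiv ℝ b (r • x) (EuclideanSpace.single j 1) : ℝ)) * chi ξ x := by
  have hd : Differentiable ℝ b := hb.differentiable (by norm_num)
  have hd1 := fun j : Fin n => (contDiff_fderiv_apply hb
    (EuclideanSpace.single j 1)).differentiable (by norm_num)
  have hsm : Differentiable ℝ fun y : EuclideanSpace ℝ (Fin n) => r • y := by fun_prop
  have hB : Differentiable ℝ fun y : EuclideanSpace ℝ (Fin n) => (b (r • y) : ℂ) :=
    Complex.ofRealCLM.differentiable.comp (hd.comp hsm)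
  have hB1 := fun j : Fin n => show Differentiable ℝ fun y : EuclideanSpace ℝ (Fin n) =>
      ((r * fderiv ℝ b (r • y) (EuclideanSpace.single j 1) : ℝ) : ℂ) from
    Complex.ofRealCLM.differentiable.comp (((hd1 j).comp hsm).const_mul r)
  have e1 : ∀ (j : Fin n) y, fderiv ℝ (fun y => (b (r • y) : ℂ) * chi ξ y) y
      (EuclideanSpace.single j 1) = (((r * fderiv ℝ b (r • y) (EuclideanSpace.single j 1) : ℝ) : ℂ)
        - 2 * Real.pi * Complex.I * ξ j * b (r • y)) * chi ξ y := fun j y => by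
    rw [fderiv_mul_chi (hB y)]
    have := fderiv_comp_smul_ofReal hd 1 r y (EuclideanSpace.single j 1)
    simp only [one_mul] at this
    rw [this]
  have e2 : ∀ j : Fin n, fderiv ℝ (fun y => fderiv ℝ (fun y => (b (r • y) : ℂ) * chi ξ y) y
      (EuclideanSpace.single j 1)) x (EuclideanSpace.single j 1) =
      (((r ^ 2 * fderiv ℝ (fun y => fderiv ℝ b y (EuclideanSpace.single j 1)) (r • x)
        (EuclideanSpace.single j 1) : ℝ) : ℂ)
        - 4 * Real.pi * Complex.I * r * ξ j * (fderiv ℝ b (r • x) (EuclideanSpace.single j 1) : ℝ)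
        - (2 * Real.pi * ξ j) ^ 2 * b (r • x)) * chi ξ x := fun j => by
    simp only [e1]
    have hdiff : DifferentiableAt ℝ (fun y =>
        ((r * fderiv ℝ b (r • y) (EuclideanSpace.single j 1) : ℝ) : ℂ)
          - 2 * Real.pi * Complex.I * ξ j * b (r • y)) x :=
      (hB1 j x).fun_sub ((hB x).const_mul _)
    rw [fderiv_mul_chi hdiff,
      fderiv_fun_sub (hB1 j x) ((hB x).const_mul _), fderiv_const_mul (hB x)]
    have h1 := fderiv_comp_smul_ofReal hd 1 r x (EuclideanSpace.single j 1)
    have h2 := fderiv_comp_smul_ofReal (hd1 j) r r x (EuclideanSpace.single j 1)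
    simp only [one_mul] at h1
    simp only [sub_apply, smul_apply, h1, h2]
    push_cast
    simp only [smul_eq_mul]
    linear_combination (-4 * Real.pi ^ 2 * ξ j ^ 2 * b (r • x) * chi ξ x) * -Complex.I_sq
  have e3 : (‖ξ‖ : ℂ) ^ 2 = ∑ j, (ξ j : ℂ) ^ 2 := by
    have := EuclideanSpace.real_norm_sq_eq ξ
    exact_mod_cast this
  simp only [laplC, e2, lapl]
  push_cast
  rw [mul_pow, e3, ← Finset.sum_mul, Finset.sum_sub_distrib, Finset.sum_sub_distrib,
    ← Finset.sum_mul]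
  simp only [mul_pow, ← Finset.mul_sum]
  ring

variable {n : ℕ}

lemma contDiff_radial_mul {h : ℝ → ℂ} (hh : ContDiffOn ℝ ∞ h (Ioi 0))
    {η : EuclideanSpace ℝ (Fin n) → ℂ} (hη : ContDiff ℝ ∞ η) (h0 : 0 ∉ tsupport η) :
    ContDiff ℝ ∞ fun ξ => h (2 * Real.pi * ‖ξ‖) * η ξ := by
  rw [contDiff_iff_contDiffAt]
  intro ξ
  rcases eq_or_ne ξ 0 with rfl | hξ
  · refine (contDiffAt_const (c := (0:ℂ))).congr_of_eventuallyEq ?_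
    filter_upwards [notMem_tsupport_iff_eventuallyEq.1 h0] with y hy
    simp [hy]
  · have hpos : 2 * Real.pi * ‖ξ‖ ∈ Ioi (0:ℝ) := by
      have := norm_pos_iff.2 hξ
      simp only [mem_Ioi]; positivity
    have h1 : ContDiffAt ℝ ∞ (fun ξ : EuclideanSpace ℝ (Fin n) => 2 * Real.pi * ‖ξ‖) ξ :=
      contDiffAt_const.mul (contDiffAt_norm ℝ hξ)
    exact ((hh.contDiffAt (Ioi_mem_nhds hpos)).comp ξ h1).mul hη.contDiffAt

lemma norm_integral_smul_fourier_le {f : EuclideanSpace ℝ (Fin n) → ℝ}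
    {k m : EuclideanSpace ℝ (Fin n) → ℂ} (hf2 : Integrable fun x => f x ^ 2) {M : ℝ}
    (hM : ∫ x, f x ^ 2 ≤ M) {B : ℝ} (hB : ∀ x, ‖k x‖ ≤ B)
    (hm : ContDiff ℝ ∞ m) (hc : HasCompactSupport m) {s : ℝ} (hs : 0 < s) :
    ‖∫ x, f x • (k x * 𝓕 m x)‖ ≤ B * ((s * M + (∫ x, ‖m x‖ ^ 2) / s) / 2) := by
  obtain ⟨h1, h2⟩ := plancherel_of_contDiff hm hc
  have hB0 : 0 ≤ B := (norm_nonneg _).trans (hB 0)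
  calc ‖∫ x, f x • (k x * 𝓕 m x)‖ ≤ ∫ x, B * ((s * f x ^ 2 + ‖𝓕 m x‖ ^ 2 / s) / 2) := by
        refine norm_integral_le_of_norm_le ?_ (Eventually.of_forall fun x => ?_)
        · exact (((hf2.const_mul s).add (h1.div_const s)).div_const 2).const_mul B
        rw [norm_smul, norm_mul, Real.norm_eq_abs]
        have : |f x| * ‖𝓕 m x‖ ≤ (s * f x ^ 2 + ‖𝓕 m x‖ ^ 2 / s) / 2 := by
          have h3 : 0 ≤ (s * |f x| - ‖𝓕 m x‖) ^ 2 / s := by positivity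
          have h4 : (s * |f x| - ‖𝓕 m x‖) ^ 2 / s =
            s * f x ^ 2 + ‖𝓕 m x‖ ^ 2 / s - 2 * (|f x| * ‖𝓕 m x‖) := by
            rw [← sq_abs (f x)]; field_simp; ring
          linarith
        calc |f x| * (‖k x‖ * ‖𝓕 m x‖) = ‖k x‖ * (|f x| * ‖𝓕 m x‖) := by ring
          _ ≤ _ := mul_le_mul (hB x) this (by positivity) hB0
    _ = B * ((s * ∫ x, f x ^ 2) + (∫ x, ‖m x‖ ^ 2) / s) / 2 := by
        rw [integral_const_mul, integral_div, integral_add (hf2.const_mul s) (h1.div_const s),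
          integral_const_mul, integral_div, h2, mul_div_assoc]
    _ ≤ _ := by
        rw [mul_div_assoc]
        gcongr

lemma integral_mul_integral_smul_chi {f : EuclideanSpace ℝ (Fin n) → ℝ}
    {k m : EuclideanSpace ℝ (Fin n) → ℂ} (hfk : Integrable fun x => f x • k x)
    (hm : Continuous m) (hc : HasCompactSupport m) :
    ∫ ξ, m ξ * ∫ x, f x • (k x * chi ξ x) = ∫ x, f x • (k x * 𝓕 m x) := by
  have h1 := integral_fourier_mul hfk (hm.integrable_of_hasCompactSupport hc)
  simp only [fourier_eq_chi (fun x => f x • k x)] at h1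
  simp only [← smul_mul_assoc]
  rw [← h1]
  refine integral_congr_ae (Eventually.of_forall fun ξ => ?_)
  simp only
  rw [mul_comm]
  congr 1
  exact integral_congr_ae (Eventually.of_forall fun x => by simp only [chi_comm x ξ, mul_comm])

lemma continuous_integral_smul_chi {X : Type*} [TopologicalSpace X] [LocallyCompactSpace X]
    [FirstCountableTopology X] {f : X → EuclideanSpace ℝ (Fin n) → ℝ}
    {k : X → EuclideanSpace ℝ (Fin n) → ℂ} {K : Set (EuclideanSpace ℝ (Fin n))}
    (hK : IsCompact K) (hk0 : ∀ p, ∀ x ∉ K, k p x = 0)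
    (hk : Continuous fun p : X × EuclideanSpace ℝ (Fin n) => k p.1 p.2)
    (hf : Continuous fun p : X × EuclideanSpace ℝ (Fin n) => f p.1 p.2) :
    Continuous fun p => ∫ x, f p x • k p x := by
  have h : ∀ p, ∫ x, f p x • k p x = ∫ x in K, f p x • k p x := fun p => by
    rw [setIntegral_eq_integral_of_forall_compl_eq_zero]
    intro x hx
    rw [hk0 p x hx, smul_zero]
  simp only [h]
  exact continuous_parametric_integral_of_continuous (hf.smul hk) hK

lemma continuous_lapl {b : EuclideanSpace ℝ (Fin n) → ℝ} (hb : ContDiff ℝ 2 b) :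
    Continuous (lapl b) :=
  continuous_finsetSum _ fun _ _ =>
    ((contDiff_fderiv_apply hb _).continuous_fderiv (by norm_num)).clm_apply continuous_const

lemma hasCompactSupport_lapl {b : EuclideanSpace ℝ (Fin n) → ℝ} (hc : HasCompactSupport b) :
    HasCompactSupport (lapl b) := by
  refine HasCompactSupport.intro hc fun x hx => Finset.sum_eq_zero fun j _ => ?_
  have h1 := tsupport_fderiv_apply_subset ℝ (f := b) (EuclideanSpace.single j 1)
  have h2 := tsupport_fderiv_apply_subset ℝ
    (f := fun y => fderiv ℝ b y (EuclideanSpace.single j 1)) (EuclideanSpace.single j 1)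
  exact image_eq_zero_of_notMem_tsupport (f := fun x => fderiv ℝ (fun y =>
    fderiv ℝ b y (EuclideanSpace.single j 1)) x (EuclideanSpace.single j 1))
    fun h => hx (h1 (h2 h))

/-- The error produced by the cutoff `b (r • ·)` in the equation satisfied by `chi ξ`. -/
noncomputable def cutoffError (b : EuclideanSpace ℝ (Fin n) → ℝ) (r : ℝ)
    (ξ x : EuclideanSpace ℝ (Fin n)) : ℂ :=
  (r ^ 2 * lapl b (r • x) : ℝ) - ∑ j, 4 * Real.pi * Complex.I * r * ξ j *
      (fderiv ℝ b (r • x) (EuclideanSpace.single j 1) : ℝ)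

lemma cutoffError_eq_zero {b : EuclideanSpace ℝ (Fin n) → ℝ} {r : ℝ}
    {x : EuclideanSpace ℝ (Fin n)} (hx : r • x ∉ tsupport b) (ξ : EuclideanSpace ℝ (Fin n)) :
    cutoffError b r ξ x = 0 := by
  have h0 : lapl b (r • x) = 0 := by
    refine Finset.sum_eq_zero fun j _ => ?_
    have h1 := tsupport_fderiv_apply_subset ℝ (f := b) (EuclideanSpace.single j 1)
    have h2 := tsupport_fderiv_apply_subset ℝ
      (f := fun y => fderiv ℝ b y (EuclideanSpace.single j 1)) (EuclideanSpace.single j 1)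
    exact image_eq_zero_of_notMem_tsupport (f := fun x => fderiv ℝ (fun y =>
      fderiv ℝ b y (EuclideanSpace.single j 1)) x (EuclideanSpace.single j 1))
      fun h => hx (h1 (h2 h))
  have h1 : fderiv ℝ b (r • x) = 0 :=
    image_eq_zero_of_notMem_tsupport fun h => hx (tsupport_fderiv_subset ℝ h)
  simp [cutoffError, h0, h1]

lemma continuous_cutoffError {b : EuclideanSpace ℝ (Fin n) → ℝ} (hb : ContDiff ℝ 2 b) (r : ℝ) :
    Continuous fun p : EuclideanSpace ℝ (Fin n) × EuclideanSpace ℝ (Fin n) =>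
      cutoffError b r p.1 p.2 := by
  have h1 := continuous_lapl hb
  have h2 := fun j : Fin n => (contDiff_fderiv_apply hb (EuclideanSpace.single j 1)).continuous
  unfold cutoffError
  refine (Complex.continuous_ofReal.comp (continuous_const.mul
    (h1.comp (by fun_prop)))).sub (continuous_finsetSum _ fun j _ => ?_)
  exact (by fun_prop : Continuous fun p : EuclideanSpace ℝ (Fin n) × EuclideanSpace ℝ (Fin n) =>
    4 * (Real.pi : ℂ) * Complex.I * r * p.1 j).mul
      (Complex.continuous_ofReal.comp ((h2 j).comp (by fun_prop)))

set_option maxHeartbeats 1000000 in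
lemma norm_integral_cutoffError_le {b : EuclideanSpace ℝ (Fin n) → ℝ} (hb : ContDiff ℝ 2 b)
    (hbc : HasCompactSupport b) {B : ℝ} (hB1 : ∀ x, |lapl b x| ≤ B)
    (hB2 : ∀ (j : Fin n) x, |fderiv ℝ b x (EuclideanSpace.single j 1)| ≤ B)
    {f : EuclideanSpace ℝ (Fin n) → ℝ} (hf : Continuous f)
    (hf2 : Integrable fun x => f x ^ 2) {M : ℝ}
    (hM : ∫ x, f x ^ 2 ≤ M) {m : EuclideanSpace ℝ (Fin n) → ℂ}
    (hm : ContDiff ℝ ∞ m) (hc : HasCompactSupport m) {r : ℝ} (hr : 0 < r) (hr1 : r ≤ 1) :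
    ‖∫ ξ, m ξ * ∫ x, f x • (cutoffError b r ξ x * chi ξ x)‖ ≤
      r * (B * ((M + ∫ x, ‖m x‖ ^ 2) / 2)
        + ∑ j, 4 * Real.pi * (B * ((M + ∫ x, ‖(x j : ℂ) * m x‖ ^ 2) / 2))) := by
  have hB0 : 0 ≤ B := (abs_nonneg _).trans (hB1 0)
  have hM0 : 0 ≤ M := (integral_nonneg fun x => sq_nonneg (f x)).trans hM
  set k0 : EuclideanSpace ℝ (Fin n) → ℂ := fun x => (lapl b (r • x) : ℝ) with hk0
  set k : Fin n → EuclideanSpace ℝ (Fin n) → ℂ := fun j x =>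
    (fderiv ℝ b (r • x) (EuclideanSpace.single j 1) : ℝ) with hk
  have hk0c : Continuous k0 := Complex.continuous_ofReal.comp
    ((continuous_lapl hb).comp (continuous_const_smul r))
  have hkc : ∀ j, Continuous (k j) := fun j => Complex.continuous_ofReal.comp
    ((contDiff_fderiv_apply hb _).continuous.comp (continuous_const_smul r))
  have hk0s : HasCompactSupport k0 :=
    ((hasCompactSupport_lapl hbc).comp_smul hr.ne').comp_left Complex.ofReal_zero
  have hks : ∀ j, HasCompactSupport (k j) := fun j =>
    ((hbc.fderiv_apply (𝕜 := ℝ) _).comp_smul hr.ne').comp_left Complex.ofReal_zero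
  have hmj : ∀ j : Fin n, ContDiff ℝ ∞ fun x : EuclideanSpace ℝ (Fin n) => (x j : ℂ) * m x :=
    fun j => (Complex.ofRealCLM.contDiff.comp
      (EuclideanSpace.proj (𝕜 := ℝ) j).contDiff).mul hm
  have hcj : ∀ j : Fin n, HasCompactSupport fun x : EuclideanSpace ℝ (Fin n) => (x j : ℂ) * m x :=
    fun j => hc.mul_left
  have hchi : ∀ ξ : EuclideanSpace ℝ (Fin n), Continuous (chi ξ) := fun ξ =>
    (contDiff_chi ξ (k := 0)).continuous
  have key : ∀ ξ, m ξ * ∫ x, f x • (cutoffError b r ξ x * chi ξ x) =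
      (r ^ 2 : ℂ) * (m ξ * ∫ x, f x • (k0 x * chi ξ x)) -
      ∑ j, (4 * Real.pi * Complex.I * r) * (((ξ j : ℂ) * m ξ) * ∫ x, f x • (k j x * chi ξ x)) := by
    intro ξ
    have e : ∀ x, f x • (cutoffError b r ξ x * chi ξ x) = (r ^ 2 : ℂ) * (f x • (k0 x * chi ξ x)) -
      ∑ j, (4 * Real.pi * Complex.I * r * ξ j) * (f x • (k j x * chi ξ x)) := fun x => by
      simp only [cutoffError, hk0, hk, Complex.real_smul, sub_mul, mul_sub, Finset.sum_mul,
        Finset.mul_sum]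
      congr 1
      · push_cast; ring
      · exact Finset.sum_congr rfl fun j _ => by ring
    have i0 : Integrable fun x => f x • (k0 x * chi ξ x) :=
      integrable_smul_of_compact hf (hk0c.mul (hchi ξ)) hk0s.mul_right
    have ij : ∀ j, Integrable fun x => f x • (k j x * chi ξ x) := fun j =>
      integrable_smul_of_compact hf ((hkc j).mul (hchi ξ)) (hks j).mul_right
    simp only [e]
    rw [integral_sub (i0.const_mul _) (integrable_finsetSum _ fun j _ => (ij j).const_mul _),
      integral_finsetSum _ fun j _ => (ij j).const_mul _]
    simp only [integral_const_mul, mul_sub, Finset.mul_sum]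
    congr 1
    · ring
    · exact Finset.sum_congr rfl fun j _ => by ring
  have hcont : ∀ κ : EuclideanSpace ℝ (Fin n) → ℂ, Continuous κ → HasCompactSupport κ →
      Continuous fun ξ => ∫ x, f x • (κ x * chi ξ x) := fun κ h1 h2 =>
    continuous_integral_smul_chi (f := fun _ => f) (k := fun ξ x => κ x * chi ξ x) h2
      (fun p x hx => by rw [image_eq_zero_of_notMem_tsupport hx, zero_mul])
      ((h1.comp continuous_snd).mul continuous_chi) (hf.comp continuous_snd)
  have hint : ∀ κ μ : EuclideanSpace ℝ (Fin n) → ℂ, Continuous κ → HasCompactSupport κ →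
      Continuous μ → HasCompactSupport μ →
      Integrable fun ξ => μ ξ * ∫ x, f x • (κ x * chi ξ x) := fun κ μ h1 h2 h3 h4 =>
    (h3.mul (hcont κ h1 h2)).integrable_of_hasCompactSupport h4.mul_right
  simp only [key]
  rw [integral_sub ((hint k0 m hk0c hk0s hm.continuous hc).const_mul _)
    (integrable_finsetSum _ fun j _ =>
      (hint (k j) _ (hkc j) (hks j) (hmj j).continuous (hcj j)).const_mul _),
    integral_finsetSum _ fun j _ =>
      (hint (k j) _ (hkc j) (hks j) (hmj j).continuous (hcj j)).const_mul _]
  simp only [integral_const_mul]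
  rw [integral_mul_integral_smul_chi (integrable_smul_of_compact hf hk0c hk0s) hm.continuous hc]
  have b0 := norm_integral_smul_fourier_le hf2 hM (k := k0) (B := B)
    (fun x => by simpa [hk0] using hB1 _) hm hc one_pos
  have bj := fun j => norm_integral_smul_fourier_le hf2 hM (k := k j) (B := B)
    (fun x => by simpa [hk] using hB2 j _) (hmj j) (hcj j) one_pos
  simp only [one_mul, div_one] at b0 bj
  refine (norm_sub_le _ _).trans ?_
  rw [mul_add, Finset.mul_sum]
  refine add_le_add ?_ ((norm_sum_le _ _).trans (Finset.sum_le_sum fun j _ => ?_))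
  · rw [norm_mul]
    have : ‖(r ^ 2 : ℂ)‖ ≤ r := by
      rw [norm_pow, Complex.norm_real, Real.norm_of_nonneg hr.le]; nlinarith
    exact mul_le_mul this b0 (norm_nonneg _) hr.le
  · rw [integral_mul_integral_smul_chi (integrable_smul_of_compact hf (hkc j) (hks j))
      (hmj j).continuous (hcj j), norm_mul]
    have : ‖(4 * Real.pi * Complex.I * r : ℂ)‖ = r * (4 * Real.pi) := by
      simp [abs_of_pos hr, abs_of_pos Real.pi_pos]; ring
    rw [this]
    exact (mul_le_mul_of_nonneg_left (bj j) (by positivity)).trans_eq (mul_assoc _ _ _)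

lemma exists_bound_lapl_fderiv {b : EuclideanSpace ℝ (Fin n) → ℝ} (hb : ContDiff ℝ 2 b)
    (hbc : HasCompactSupport b) :
    ∃ B, (∀ x, |lapl b x| ≤ B) ∧
      ∀ (j : Fin n) x, |fderiv ℝ b x (EuclideanSpace.single j 1)| ≤ B := by
  obtain ⟨B0, hB0⟩ := (hasCompactSupport_lapl hbc).exists_bound_of_continuous (continuous_lapl hb)
  have hBj := fun j : Fin n => (hbc.fderiv_apply (𝕜 := ℝ)
    (EuclideanSpace.single j 1)).exists_bound_of_continuous (contDiff_fderiv_apply hb _).continuous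
  choose Bj hBj using hBj
  refine ⟨|B0| + ∑ j, |Bj j|, fun x => ?_, fun j x => ?_⟩
  · exact (hB0 x).trans ((le_abs_self _).trans (le_add_of_nonneg_right
      (Finset.sum_nonneg fun _ _ => abs_nonneg _)))
  · exact (hBj j x).trans ((le_abs_self _).trans ((Finset.single_le_sum (f := fun j => |Bj j|)
      (fun _ _ => abs_nonneg _) (Finset.mem_univ j)).trans
        (le_add_of_nonneg_left (abs_nonneg _))))

lemma continuous_integral_cutoffError {b : EuclideanSpace ℝ (Fin n) → ℝ} (hb : ContDiff ℝ 2 b)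
    (hbc : HasCompactSupport b) {f : ℝ → EuclideanSpace ℝ (Fin n) → ℝ}
    (hf : Continuous fun p : ℝ × EuclideanSpace ℝ (Fin n) => f p.1 p.2) {r : ℝ} (hr : r ≠ 0) :
    Continuous fun p : ℝ × EuclideanSpace ℝ (Fin n) =>
      ∫ x, f p.1 x • (cutoffError b r p.2 x * chi p.2 x) := by
  refine continuous_integral_smul_chi (f := fun p : ℝ × EuclideanSpace ℝ (Fin n) => f p.1)
    (k := fun p x => cutoffError b r p.2 x * chi p.2 x) (hbc.comp_smul hr)
    (fun p x hx => ?_) ?_ ?_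
  · rw [cutoffError_eq_zero, zero_mul]
    intro h
    refine hx ?_
    rw [show (fun x => b (r • x)) = b ∘ (Homeomorph.smulOfNeZero r hr) from rfl,
      tsupport_comp_eq_preimage]
    exact h
  · have h1 := (continuous_cutoffError hb r).comp (by fun_prop :
      Continuous fun q : (ℝ × EuclideanSpace ℝ (Fin n)) × EuclideanSpace ℝ (Fin n) =>
        (q.1.2, q.2))
    have h2 := (continuous_chi (n := n)).comp (by fun_prop :
      Continuous fun q : (ℝ × EuclideanSpace ℝ (Fin n)) × EuclideanSpace ℝ (Fin n) =>
        (q.1.2, q.2))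
    exact h1.mul h2
  · exact hf.comp (by fun_prop :
      Continuous fun q : (ℝ × EuclideanSpace ℝ (Fin n)) × EuclideanSpace ℝ (Fin n) =>
        (q.1.1, q.2))

lemma integral_mul_intervalIntegral_swap {s I : ℝ → EuclideanSpace ℝ (Fin n) → ℂ}
    {η : EuclideanSpace ℝ (Fin n) → ℂ}
    (hs : Continuous fun p : ℝ × EuclideanSpace ℝ (Fin n) => s p.1 p.2)
    (hI : Continuous fun p : ℝ × EuclideanSpace ℝ (Fin n) => I p.1 p.2)
    (hη : Continuous η) (hc : HasCompactSupport η) {T : ℝ} (hT : 0 ≤ T) :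
    ∫ ξ, η ξ * ∫ t in (0:ℝ)..T, s t ξ * I t ξ =
      ∫ t in (0:ℝ)..T, ∫ ξ, (s t ξ * η ξ) * I t ξ := by
  rw [intervalIntegral_integral_swap]
  · refine integral_congr_ae (Eventually.of_forall fun ξ => ?_)
    simp only [← intervalIntegral.integral_const_mul]
    refine intervalIntegral.integral_congr fun t _ => ?_
    ring
  · have e : ((volume : Measure ℝ).restrict (uIoc 0 T)).prod
        (volume : Measure (EuclideanSpace ℝ (Fin n))) =
        (volume.prod volume).restrict (Ioc 0 T ×ˢ univ) := by
      rw [← Measure.prod_restrict, Measure.restrict_univ, uIoc_of_le hT]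
    rw [e]
    have h1 : IntegrableOn (Function.uncurry fun t ξ => (s t ξ * η ξ) * I t ξ)
        (Icc 0 T ×ˢ tsupport η)
        ((volume : Measure ℝ).prod (volume : Measure (EuclideanSpace ℝ (Fin n)))) := by
      refine ContinuousOn.integrableOn_compact (isCompact_Icc.prod hc) (Continuous.continuousOn ?_)
      exact (hs.mul (hη.comp continuous_snd)).mul hI
    refine (h1.of_forall_sdiff_eq_zero (t := Icc 0 T ×ˢ univ)
      (measurableSet_Icc.prod MeasurableSet.univ) ?_).mono_set
        (prod_mono Ioc_subset_Icc_self subset_rfl)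
    rintro ⟨t, ξ⟩ ⟨⟨h2, -⟩, h3⟩
    have : η ξ = 0 := image_eq_zero_of_notMem_tsupport fun h => h3 ⟨h2, h⟩
    simp [this]

lemma integral_norm_sq_sinh_le {w η : EuclideanSpace ℝ (Fin n) → ℂ} (hw : Continuous w)
    (hη : Continuous η) (hc : HasCompactSupport η) {t T : ℝ} (ht : t ∈ Ioc 0 T) :
    ∫ ξ, ‖w ξ * ((Real.sinh (2 * Real.pi * ‖ξ‖ * (T - t)) : ℂ) * η ξ)‖ ^ 2 ≤
      ∫ ξ, ‖w ξ * ((Real.sinh (2 * Real.pi * ‖ξ‖ * T) : ℂ) * η ξ)‖ ^ 2 := by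
  have hint : ∀ s : ℝ, Integrable fun ξ =>
      ‖w ξ * ((Real.sinh (2 * Real.pi * ‖ξ‖ * s) : ℂ) * η ξ)‖ ^ 2 := fun s => by
    have h0 : Continuous fun ξ : EuclideanSpace ℝ (Fin n) =>
        (Real.sinh (2 * Real.pi * ‖ξ‖ * s) : ℂ) :=
      Complex.continuous_ofReal.comp (Real.continuous_sinh.comp (by fun_prop))
    have h1 : Continuous fun ξ => w ξ * ((Real.sinh (2 * Real.pi * ‖ξ‖ * s) : ℂ) * η ξ) :=
      hw.mul (h0.mul hη)
    have h2 : HasCompactSupport fun ξ =>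
        ‖w ξ * ((Real.sinh (2 * Real.pi * ‖ξ‖ * s) : ℂ) * η ξ)‖ ^ 2 := by
      refine HasCompactSupport.intro hc fun ξ hξ => ?_
      simp [image_eq_zero_of_notMem_tsupport hξ]
    exact (h1.norm.pow 2).integrable_of_hasCompactSupport h2
  refine integral_mono (hint _) (hint _) fun ξ => ?_
  simp only [norm_mul, Complex.norm_real, Real.norm_eq_abs]
  have h1 : 0 ≤ T - t := by linarith [ht.2]
  have h2 : |Real.sinh (2 * Real.pi * ‖ξ‖ * (T - t))| ≤ |Real.sinh (2 * Real.pi * ‖ξ‖ * T)| := by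
    rw [Real.abs_sinh, Real.abs_sinh, Real.sinh_le_sinh]
    have h3 : 0 ≤ T := ht.1.le.trans ht.2
    rw [abs_of_nonneg (by positivity), abs_of_nonneg (by positivity)]
    exact mul_le_mul_of_nonneg_left (by linarith [ht.1]) (by positivity)
  gcongr

lemma norm_slab_cutoffError_le {b : EuclideanSpace ℝ (Fin n) → ℝ} (hb : ContDiff ℝ 2 b)
    (hbc : HasCompactSupport b) {f : ℝ → EuclideanSpace ℝ (Fin n) → ℝ}
    (hf : Continuous fun p : ℝ × EuclideanSpace ℝ (Fin n) => f p.1 p.2)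
    (hf2 : ∀ t, 0 < t → Integrable fun x => f t x ^ 2) {M : ℝ}
    (hM : ∀ t, 0 < t → ∫ x, f t x ^ 2 ≤ M) {η : EuclideanSpace ℝ (Fin n) → ℂ}
    (hη : ContDiff ℝ ∞ η) (hc : HasCompactSupport η) (h0 : 0 ∉ tsupport η) {T : ℝ} (hT : 0 < T) :
    ∃ C, ∀ r, 0 < r → r ≤ 1 →
      ‖∫ ξ, η ξ * ∫ t in (0:ℝ)..T, (Real.sinh (2 * Real.pi * ‖ξ‖ * (T - t)) : ℂ) *
        ∫ x, f t x • (cutoffError b r ξ x * chi ξ x)‖ ≤ r * C := by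
  obtain ⟨B, hB1, hB2⟩ := exists_bound_lapl_fderiv hb hbc
  have hBpos : 0 ≤ B := (abs_nonneg _).trans (hB1 0)
  set S : EuclideanSpace ℝ (Fin n) → ℂ := fun ξ =>
    (Real.sinh (2 * Real.pi * ‖ξ‖ * T) : ℂ) * η ξ with hS
  refine ⟨(B * ((M + ∫ x, ‖S x‖ ^ 2) / 2) + ∑ j, 4 * Real.pi *
    (B * ((M + ∫ x : EuclideanSpace ℝ (Fin n), ‖(x j : ℂ) * S x‖ ^ 2) / 2))) * T,
    fun r hr hr1 => ?_⟩
  rw [integral_mul_intervalIntegral_swap (s := fun t ξ =>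
    (Real.sinh (2 * Real.pi * ‖ξ‖ * (T - t)) : ℂ)) (I := fun t ξ => ∫ x, f t x •
      (cutoffError b r ξ x * chi ξ x)) (Complex.continuous_ofReal.comp
      (Real.continuous_sinh.comp (by fun_prop))) (continuous_integral_cutoffError hb hbc hf hr.ne')
      hη.continuous hc hT.le]
  refine (intervalIntegral.norm_integral_le_of_norm_le_const (C := r * (B * ((M +
    ∫ x, ‖S x‖ ^ 2) / 2) + ∑ j, 4 * Real.pi * (B * ((M + ∫ x : EuclideanSpace ℝ (Fin n),
      ‖(x j : ℂ) * S x‖ ^ 2) / 2)))) fun t ht => ?_).trans_eq ?_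
  · rw [uIoc_of_le hT.le] at ht
    have hms := contDiff_radial_mul (h := fun a => (Real.sinh (a * (T - t)) : ℂ))
      ((Complex.ofRealCLM.contDiff.comp (Real.contDiff_sinh.comp
        (contDiff_id.mul contDiff_const))).contDiffOn) hη h0
    refine (norm_integral_cutoffError_le (f := f t) hb hbc hB1 hB2
      (hf.comp (by fun_prop : Continuous fun x => (t, x))) (hf2 t ht.1)
      (hM t ht.1) hms hc.mul_left hr hr1).trans ?_
    have h1 := integral_norm_sq_sinh_le (w := fun _ => 1) continuous_const hη.continuous hc ht
    have h2 := fun j : Fin n => integral_norm_sq_sinh_le (w := fun ξ => (ξ j : ℂ)) (by fun_prop)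
      hη.continuous hc ht
    simp only [one_mul] at h1
    refine mul_le_mul_of_nonneg_left (add_le_add ?_ (Finset.sum_le_sum fun j _ => ?_)) hr.le
    · refine mul_le_mul_of_nonneg_left ?_ hBpos
      linarith
    · refine mul_le_mul_of_nonneg_left (mul_le_mul_of_nonneg_left ?_ hBpos) (by positivity)
      linarith [h2 j]
  · rw [sub_zero, abs_of_pos hT]
    ring

lemma tendsto_integral_cutoff {b : EuclideanSpace ℝ (Fin n) → ℝ} (hb : Continuous b)
    (hb0 : b 0 = 1) (hb1 : ∀ x, |b x| ≤ 1) {f : EuclideanSpace ℝ (Fin n) → ℝ}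
    (hf : Continuous f) (hf2 : Integrable fun x => f x ^ 2)
    {m : EuclideanSpace ℝ (Fin n) → ℂ} (hm : ContDiff ℝ ∞ m) (hc : HasCompactSupport m) :
    Tendsto (fun r : ℝ => ∫ x, f x • ((b (r • x) : ℂ) * 𝓕 m x)) (𝓝[>] 0)
      (𝓝 (∫ x, f x • 𝓕 m x)) := by
  have hFc : Continuous (𝓕 m) :=
    continuous_fourier_of_integrable (hm.continuous.integrable_of_hasCompactSupport hc)
  have hi := hf2.add (plancherel_of_contDiff hm hc).1
  refine tendsto_integral_filter_of_dominated_convergence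
    (fun x => f x ^ 2 + ‖𝓕 m x‖ ^ 2) ?_ ?_ hi ?_
  · refine Eventually.of_forall fun r => Continuous.aestronglyMeasurable ?_
    exact hf.smul ((Complex.continuous_ofReal.comp (hb.comp (continuous_const_smul r))).mul hFc)
  · refine Eventually.of_forall fun r => Eventually.of_forall fun x => ?_
    rw [norm_smul, norm_mul, Complex.norm_real, Real.norm_eq_abs, Real.norm_eq_abs]
    have h1 : |b (r • x)| * ‖𝓕 m x‖ ≤ ‖𝓕 m x‖ :=
      mul_le_of_le_one_left (norm_nonneg _) (hb1 _)
    have h2 := mul_le_mul_of_nonneg_left h1 (abs_nonneg (f x))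
    nlinarith [sq_nonneg (|f x| - ‖𝓕 m x‖), sq_abs (f x), sq_nonneg (f x), sq_nonneg ‖𝓕 m x‖]
  · refine Eventually.of_forall fun x => ?_
    have h1 : Tendsto (fun r : ℝ => b (r • x)) (𝓝[>] 0) (𝓝 1) := by
      have : Continuous fun r : ℝ => b (r • x) := hb.comp (by fun_prop)
      have h2 := (this.tendsto 0).mono_left (nhdsWithin_le_nhds (s := Ioi 0))
      simpa [hb0] using h2
    have h2 : Tendsto (fun r : ℝ => f x • ((b (r • x) : ℂ) * 𝓕 m x)) (𝓝[>] 0)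
        (𝓝 (f x • (((1:ℝ) : ℂ) * 𝓕 m x))) :=
      (((Complex.continuous_ofReal.tendsto 1).comp h1).mul_const _).const_smul _
    simpa using h2

lemma exists_cutoff (n : ℕ) : ∃ b : EuclideanSpace ℝ (Fin n) → ℝ,
    ContDiff ℝ 2 b ∧ HasCompactSupport b ∧ b 0 = 1 ∧ ∀ x, |b x| ≤ 1 := by
  let f : ContDiffBump (0 : EuclideanSpace ℝ (Fin n)) := ⟨1, 2, one_pos, one_lt_two⟩
  exact ⟨f, f.contDiff, f.hasCompactSupport,
    f.one_of_mem_closedBall (Metric.mem_closedBall_self one_pos.le),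
    fun x => by rw [abs_of_nonneg f.nonneg]; exact f.le_one⟩

lemma green_slab_cutoff {u : EuclideanSpace ℝ (Fin (n+1)) → ℝ}
    (hu1 : ContDiffOn ℝ 1 u (closedHalf n)) (hu : HarmonicOnSet u (openHalf n))
    {b : EuclideanSpace ℝ (Fin n) → ℝ} (hb : ContDiff ℝ 2 b) (hbc : HasCompactSupport b)
    {r : ℝ} (hr : r ≠ 0) {T : ℝ} (hT : 0 < T) (ξ : EuclideanSpace ℝ (Fin n)) :
    ∫ t in (0:ℝ)..T, (Real.sinh (2 * Real.pi * ‖ξ‖ * (T - t)) : ℂ) *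
        ∫ x, slice u t x • (cutoffError b r ξ x * chi ξ x) =
      (2 * Real.pi * ‖ξ‖ * Real.cosh (2 * Real.pi * ‖ξ‖ * T) : ℝ) *
        (∫ x, slice u 0 x • ((b (r • x) : ℂ) * chi ξ x))
      + (Real.sinh (2 * Real.pi * ‖ξ‖ * T) : ℝ) * (∫ x, dt u 0 x • ((b (r • x) : ℂ) * chi ξ x))
      - (2 * Real.pi * ‖ξ‖ : ℝ) * ∫ x, slice u T x • ((b (r • x) : ℂ) * chi ξ x) := by
  have h1 : ContDiff ℝ 2 fun x => (b (r • x) : ℂ) * chi ξ x :=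
    (Complex.ofRealCLM.contDiff.comp (hb.comp (contDiff_const_smul r))).mul (contDiff_chi ξ)
  have h2 : HasCompactSupport fun x => (b (r • x) : ℂ) * chi ξ x :=
    ((hbc.comp_smul hr).comp_left Complex.ofReal_zero).mul_right
  have h3 := green_slab hu1 hu h1 h2 (2 * Real.pi * ‖ξ‖) hT
  simp only [laplC_cutoff_mul_chi hb] at h3
  simp only [cutoffError]
  rw [h3]
  ring

lemma continuous_integral_cutoff_chi {b : EuclideanSpace ℝ (Fin n) → ℝ} (hb : Continuous b)
    (hbc : HasCompactSupport b) {f : EuclideanSpace ℝ (Fin n) → ℝ} (hf : Continuous f)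
    {r : ℝ} (hr : r ≠ 0) :
    Continuous fun ξ => ∫ x, f x • ((b (r • x) : ℂ) * chi ξ x) := by
  refine continuous_integral_smul_chi (f := fun _ => f)
    (k := fun ξ x => (b (r • x) : ℂ) * chi ξ x) (hbc.comp_smul hr) (fun p x hx => ?_) ?_
    (hf.comp continuous_snd)
  · have : b (r • x) = 0 := image_eq_zero_of_notMem_tsupport (f := fun x => b (r • x)) hx
    simp [this]
  · have h1 : Continuous fun q : EuclideanSpace ℝ (Fin n) × EuclideanSpace ℝ (Fin n) =>
        (b (r • q.2) : ℂ) := Complex.continuous_ofReal.comp (hb.comp (by fun_prop))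
    exact h1.mul continuous_chi

lemma slab_identity {u : EuclideanSpace ℝ (Fin (n+1)) → ℝ}
    (hu1 : ContDiffOn ℝ 1 u (closedHalf n)) (hu : HarmonicOnSet u (openHalf n))
    (hf2 : ∀ t, 0 < t → Integrable fun x => slice u t x ^ 2) {M : ℝ}
    (hM : ∀ t, 0 < t → ∫ x, slice u t x ^ 2 ≤ M)
    (h02 : Integrable fun x => slice u 0 x ^ 2) (hg2 : Integrable fun x => dt u 0 x ^ 2)
    {η : EuclideanSpace ℝ (Fin n) → ℂ}
    (hη : ContDiff ℝ ∞ η) (hc : HasCompactSupport η) (h0 : 0 ∉ tsupport η) {T : ℝ} (hT : 0 < T) :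
    ∫ x, slice u T x • 𝓕 (fun ξ => ((2 * Real.pi * ‖ξ‖ : ℝ) : ℂ) * η ξ) x =
      (∫ x, slice u 0 x • 𝓕 (fun ξ =>
        ((2 * Real.pi * ‖ξ‖ * Real.cosh (2 * Real.pi * ‖ξ‖ * T) : ℝ) : ℂ) * η ξ) x)
      + ∫ x, dt u 0 x • 𝓕 (fun ξ => (Real.sinh (2 * Real.pi * ‖ξ‖ * T) : ℂ) * η ξ) x := by
  obtain ⟨b, hb, hbc, hb0, hb1⟩ := exists_cutoff n
  have hs := continuous_slice hu1
  have hsT : Continuous (slice u T) := hs.comp (by fun_prop : Continuous fun x => (T, x))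
  have hs0 : Continuous (slice u 0) := hs.comp (by fun_prop : Continuous fun x => ((0:ℝ), x))
  have hg0 : Continuous (dt u 0) :=
    (continuous_dt hu1).comp (by fun_prop : Continuous fun x => ((0:ℝ), x))
  have m1 : ContDiff ℝ ∞ fun ξ => ((2 * Real.pi * ‖ξ‖ : ℝ) : ℂ) * η ξ :=
    contDiff_radial_mul (h := fun a => (a : ℂ)) Complex.ofRealCLM.contDiff.contDiffOn hη h0
  have m2 : ContDiff ℝ ∞ fun ξ =>
      ((2 * Real.pi * ‖ξ‖ * Real.cosh (2 * Real.pi * ‖ξ‖ * T) : ℝ) : ℂ) * η ξ :=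
    contDiff_radial_mul (h := fun a => ((a * Real.cosh (a * T) : ℝ) : ℂ))
      (Complex.ofRealCLM.contDiff.comp (contDiff_id.mul (Real.contDiff_cosh.comp
        (contDiff_id.mul contDiff_const)))).contDiffOn hη h0
  have m3 : ContDiff ℝ ∞ fun ξ => (Real.sinh (2 * Real.pi * ‖ξ‖ * T) : ℂ) * η ξ :=
    contDiff_radial_mul (h := fun a => (Real.sinh (a * T) : ℂ))
      ((Complex.ofRealCLM.contDiff.comp (Real.contDiff_sinh.comp
        (contDiff_id.mul contDiff_const))).contDiffOn) hη h0
  have c1 : HasCompactSupport fun ξ => ((2 * Real.pi * ‖ξ‖ : ℝ) : ℂ) * η ξ := hc.mul_left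
  have c2 : HasCompactSupport fun ξ =>
      ((2 * Real.pi * ‖ξ‖ * Real.cosh (2 * Real.pi * ‖ξ‖ * T) : ℝ) : ℂ) * η ξ := hc.mul_left
  have c3 : HasCompactSupport fun ξ => (Real.sinh (2 * Real.pi * ‖ξ‖ * T) : ℂ) * η ξ :=
    hc.mul_left
  obtain ⟨C, hC⟩ := norm_slab_cutoffError_le hb hbc hs hf2 hM hη hc h0 hT
  have flip : ∀ {f : EuclideanSpace ℝ (Fin n) → ℝ} {m : EuclideanSpace ℝ (Fin n) → ℂ},
      Continuous f → ContDiff ℝ ∞ m → HasCompactSupport m → ∀ r : ℝ, r ≠ 0 →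
      Integrable (fun ξ => m ξ * ∫ x, f x • ((b (r • x) : ℂ) * chi ξ x)) ∧
      ∫ ξ, m ξ * ∫ x, f x • ((b (r • x) : ℂ) * chi ξ x) =
        ∫ x, f x • ((b (r • x) : ℂ) * 𝓕 m x) := fun {f m} hf hm hmc r hr => by
    refine ⟨(hm.continuous.mul (continuous_integral_cutoff_chi hb.continuous hbc hf
      hr)).integrable_of_hasCompactSupport hmc.mul_right, ?_⟩
    refine integral_mul_integral_smul_chi (k := fun x => (b (r • x) : ℂ)) ?_ hm.continuous hmc
    exact integrable_smul_of_compact hf (Complex.continuous_ofReal.comp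
      (hb.continuous.comp (continuous_const_smul r)))
      ((hbc.comp_smul hr).comp_left Complex.ofReal_zero)
  have hr : ∀ r : ℝ, 0 < r → r ≤ 1 →
      ‖(∫ x, slice u 0 x • ((b (r • x) : ℂ) * 𝓕 (fun ξ =>
        ((2 * Real.pi * ‖ξ‖ * Real.cosh (2 * Real.pi * ‖ξ‖ * T) : ℝ) : ℂ) * η ξ) x))
      + (∫ x, dt u 0 x • ((b (r • x) : ℂ) * 𝓕 (fun ξ =>
          (Real.sinh (2 * Real.pi * ‖ξ‖ * T) : ℂ) * η ξ) x))
      - ∫ x, slice u T x • ((b (r • x) : ℂ) * 𝓕 (fun ξ =>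
          ((2 * Real.pi * ‖ξ‖ : ℝ) : ℂ) * η ξ) x)‖ ≤ r * C := fun r hr hr1 => by
    have hbound := hC r hr hr1
    obtain ⟨i1, e1⟩ := flip hsT m1 c1 r hr.ne'
    obtain ⟨i2, e2⟩ := flip hs0 m2 c2 r hr.ne'
    obtain ⟨i3, e3⟩ := flip hg0 m3 c3 r hr.ne'
    rw [← e1, ← e2, ← e3, ← integral_add i2 i3]
    simp only [green_slab_cutoff hu1 hu hb hbc hr.ne' hT] at hbound
    refine (le_of_eq (congrArg norm ?_)).trans hbound
    refine (integral_sub (i2.add i3) i1).symm.trans ?_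
    refine integral_congr_ae (Eventually.of_forall fun ξ => ?_)
    simp only [Pi.add_apply]
    ring
  have l1 := tendsto_integral_cutoff hb.continuous hb0 hb1 hsT (hf2 T hT) m1 c1
  have l2 := tendsto_integral_cutoff hb.continuous hb0 hb1 hs0 h02 m2 c2
  have l3 := tendsto_integral_cutoff hb.continuous hb0 hb1 hg0 hg2 m3 c3
  have l4 : Tendsto (fun r : ℝ => r * C) (𝓝[>] 0) (𝓝 0) := by
    have : Tendsto (fun r : ℝ => r * C) (𝓝 0) (𝓝 (0 * C)) := (continuous_id.mul_const C).tendsto 0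
    rw [zero_mul] at this
    exact this.mono_left nhdsWithin_le_nhds
  have l5 := le_of_tendsto_of_tendsto ((l2.add l3).sub l1).norm l4 (by
    filter_upwards [Ioc_mem_nhdsGT (zero_lt_one (α := ℝ))] with r h using hr r h.1 h.2)
  exact (sub_eq_zero.1 (norm_le_zero_iff.1 l5)).symm

lemma integral_smul_fourier {f : EuclideanSpace ℝ (Fin n) → ℝ}
    {m : EuclideanSpace ℝ (Fin n) → ℂ} (hf : Integrable f) (hm : Integrable m) :
    ∫ x, f x • 𝓕 m x = ∫ ξ, 𝓕 (fun x => (f x : ℂ)) ξ * m ξ := by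
  rw [integral_fourier_mul (f := fun x => (f x : ℂ)) hf.ofReal hm]
  simp only [Complex.real_smul]

/-- Integrals against `exp (-2aT)`, with `a = 2π‖ξ‖`, tend to zero as `T → ∞`. -/
lemma tendsto_integral_exp_mul {Q : EuclideanSpace ℝ (Fin n) → ℂ} (hQ : Integrable Q)
    (hQ0 : Q 0 = 0) :
    Tendsto (fun T : ℝ => ∫ ξ, (Real.exp (-2 * (2 * Real.pi * ‖ξ‖ * T)) : ℂ) * Q ξ) atTop
      (𝓝 0) := by
  have h : Tendsto (fun T : ℝ => ∫ ξ, (Real.exp (-2 * (2 * Real.pi * ‖ξ‖ * T)) : ℂ) * Q ξ) atTop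
      (𝓝 (∫ _ : EuclideanSpace ℝ (Fin n), (0:ℂ))) := by
    refine tendsto_integral_filter_of_dominated_convergence (fun ξ => ‖Q ξ‖) ?_ ?_ hQ.norm ?_
    · refine Eventually.of_forall fun T => AEStronglyMeasurable.mul ?_ hQ.1
      exact Continuous.aestronglyMeasurable (Complex.continuous_ofReal.comp
        (Real.continuous_exp.comp (by fun_prop)))
    · filter_upwards [eventually_ge_atTop (0:ℝ)] with T hT
      refine Eventually.of_forall fun ξ => ?_
      rw [norm_mul, Complex.norm_real, Real.norm_eq_abs, Real.abs_exp]
      refine mul_le_of_le_one_left (norm_nonneg _) (Real.exp_le_one_iff.2 ?_)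
      have : 0 ≤ 2 * Real.pi * ‖ξ‖ * T := by positivity
      linarith
    · refine Eventually.of_forall fun ξ => ?_
      rcases eq_or_ne ξ 0 with rfl | hξ
      · simp [hQ0]
      have hpos : 0 < 2 * Real.pi * ‖ξ‖ := by
        have := norm_pos_iff.2 hξ
        positivity
      have h1 : Tendsto (fun T : ℝ => Real.exp (-2 * (2 * Real.pi * ‖ξ‖ * T))) atTop (𝓝 0) :=
        Real.tendsto_exp_atBot.comp ((tendsto_id.const_mul_atTop hpos).const_mul_atTop_of_neg
          (by norm_num))
      simpa using ((Complex.continuous_ofReal.tendsto 0).comp h1).mul_const (Q ξ)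
  simpa using h

lemma integral_mul_fourier_relation {u : EuclideanSpace ℝ (Fin (n+1)) → ℝ}
    (hu1 : ContDiffOn ℝ 1 u (closedHalf n)) (hu : HarmonicOnSet u (openHalf n))
    (hf2 : ∀ t, 0 < t → Integrable fun x => slice u t x ^ 2) {M : ℝ}
    (hM : ∀ t, 0 < t → ∫ x, slice u t x ^ 2 ≤ M)
    (h02 : Integrable fun x => slice u 0 x ^ 2) (hg2 : Integrable fun x => dt u 0 x ^ 2)
    (h01 : Integrable (slice u 0)) (hg1 : Integrable (dt u 0))
    {θ : EuclideanSpace ℝ (Fin n) → ℂ}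
    (hθ : ContDiff ℝ ∞ θ) (hc : HasCompactSupport θ) (h0 : 0 ∉ tsupport θ) :
    ∫ ξ, θ ξ * ((2 * Real.pi * ‖ξ‖ : ℝ) * 𝓕 (fun x => (slice u 0 x : ℂ)) ξ
      + 𝓕 (fun x => (dt u 0 x : ℂ)) ξ) = 0 := by
  set A := 𝓕 (fun x => (slice u 0 x : ℂ)) with hA
  set G := 𝓕 (fun x => (dt u 0 x : ℂ)) with hG
  have hAc : Continuous A := continuous_fourier_of_integrable h01.ofReal
  have hGc : Continuous G := continuous_fourier_of_integrable hg1.ofReal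
  set P : EuclideanSpace ℝ (Fin n) → ℂ := fun ξ =>
    θ ξ * ((2 * Real.pi * ‖ξ‖ : ℝ) * A ξ + G ξ) with hP
  set Q : EuclideanSpace ℝ (Fin n) → ℂ := fun ξ =>
    θ ξ * ((2 * Real.pi * ‖ξ‖ : ℝ) * A ξ - G ξ) with hQ
  have hac : Continuous fun ξ : EuclideanSpace ℝ (Fin n) => ((2 * Real.pi * ‖ξ‖ : ℝ) : ℂ) := by
    fun_prop
  have hPi : Integrable P := (hθ.continuous.mul
    ((hac.mul hAc).add hGc)).integrable_of_hasCompactSupport hc.mul_right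
  have hQi : Integrable Q := (hθ.continuous.mul
    ((hac.mul hAc).sub hGc)).integrable_of_hasCompactSupport hc.mul_right
  have hbound : ∀ T : ℝ, 0 < T → ‖(1 / 2 : ℂ) * ((∫ ξ, P ξ) +
      ∫ ξ, (Real.exp (-2 * (2 * Real.pi * ‖ξ‖ * T)) : ℂ) * Q ξ)‖ ≤
      ((M + ∫ ξ, ‖θ ξ‖ ^ 2) / 2) * T⁻¹ := fun T hT => by
    set η : EuclideanSpace ℝ (Fin n) → ℂ := fun ξ =>
      (Real.exp (-(2 * Real.pi * ‖ξ‖ * T)) : ℂ) * θ ξ with hη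
    have hηs : ContDiff ℝ ∞ η :=
      contDiff_radial_mul (h := fun a => (Real.exp (-(a * T)) : ℂ))
        (Complex.ofRealCLM.contDiff.comp (Real.contDiff_exp.comp
          (contDiff_id.mul contDiff_const).neg)).contDiffOn hθ h0
    have hηc : HasCompactSupport η := hc.mul_left
    have hη0 : 0 ∉ tsupport η := fun h => h0 (tsupport_mul_subset_right h)
    have m1 : ContDiff ℝ ∞ fun ξ => ((2 * Real.pi * ‖ξ‖ : ℝ) : ℂ) * η ξ :=
      contDiff_radial_mul (h := fun a => (a : ℂ)) Complex.ofRealCLM.contDiff.contDiffOn hηs hη0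
    have c1 : HasCompactSupport fun ξ => ((2 * Real.pi * ‖ξ‖ : ℝ) : ℂ) * η ξ := hηc.mul_left
    have hch : Continuous fun ξ : EuclideanSpace ℝ (Fin n) =>
        ((2 * Real.pi * ‖ξ‖ * Real.cosh (2 * Real.pi * ‖ξ‖ * T) : ℝ) : ℂ) := by
      refine Complex.continuous_ofReal.comp (Continuous.mul (by fun_prop)
        (Real.continuous_cosh.comp (by fun_prop)))
    have hsh : Continuous fun ξ : EuclideanSpace ℝ (Fin n) =>
        (Real.sinh (2 * Real.pi * ‖ξ‖ * T) : ℂ) :=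
      Complex.continuous_ofReal.comp (Real.continuous_sinh.comp (by fun_prop))
    have i2 : Integrable fun ξ =>
        ((2 * Real.pi * ‖ξ‖ * Real.cosh (2 * Real.pi * ‖ξ‖ * T) : ℝ) : ℂ) * η ξ :=
      (hch.mul hηs.continuous).integrable_of_hasCompactSupport hηc.mul_left
    have i3 : Integrable fun ξ => (Real.sinh (2 * Real.pi * ‖ξ‖ * T) : ℂ) * η ξ :=
      (hsh.mul hηs.continuous).integrable_of_hasCompactSupport hηc.mul_left
    have hid := slab_identity hu1 hu hf2 hM h02 hg2 hηs hηc hη0 hT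
    rw [integral_smul_fourier h01 i2, integral_smul_fourier hg1 i3] at hid
    have j2 : Integrable fun ξ => A ξ *
        (((2 * Real.pi * ‖ξ‖ * Real.cosh (2 * Real.pi * ‖ξ‖ * T) : ℝ) : ℂ) * η ξ) :=
      (hAc.mul (hch.mul hηs.continuous)).integrable_of_hasCompactSupport
      hηc.mul_left.mul_left
    have j3 : Integrable fun ξ => G ξ * ((Real.sinh (2 * Real.pi * ‖ξ‖ * T) : ℂ) * η ξ) :=
      (hGc.mul (hsh.mul hηs.continuous)).integrable_of_hasCompactSupport
      hηc.mul_left.mul_left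
    have hEQ : Integrable fun ξ => (Real.exp (-2 * (2 * Real.pi * ‖ξ‖ * T)) : ℂ) * Q ξ := by
      have hec : Continuous fun ξ : EuclideanSpace ℝ (Fin n) =>
        (Real.exp (-2 * (2 * Real.pi * ‖ξ‖ * T)) : ℂ) :=
        Complex.continuous_ofReal.comp (Real.continuous_exp.comp (by fun_prop))
      exact (hec.mul (hθ.continuous.mul
        ((hac.mul hAc).sub hGc))).integrable_of_hasCompactSupport hc.mul_right.mul_left
    have hrw : (1 / 2 : ℂ) * ((∫ ξ, P ξ) +
        ∫ ξ, (Real.exp (-2 * (2 * Real.pi * ‖ξ‖ * T)) : ℂ) * Q ξ) =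
        ∫ x, slice u T x • 𝓕 (fun ξ => ((2 * Real.pi * ‖ξ‖ : ℝ) : ℂ) * η ξ) x := by
      rw [hid, ← integral_add hPi hEQ, ← integral_const_mul]
      refine Eq.trans ?_ (integral_add j2 j3)
      refine integral_congr_ae (Eventually.of_forall fun ξ => ?_)
      set a := 2 * Real.pi * ‖ξ‖ with ha
      have e1 : Real.cosh (a * T) * Real.exp (-(a * T)) = (1 + Real.exp (-2 * (a * T))) / 2 := by
        rw [Real.cosh_eq, div_mul_eq_mul_div, add_mul, ← Real.exp_add, ← Real.exp_add]
        ring_nf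
        simp
      have e2 : Real.sinh (a * T) * Real.exp (-(a * T)) = (1 - Real.exp (-2 * (a * T))) / 2 := by
        rw [Real.sinh_eq, div_mul_eq_mul_div, sub_mul, ← Real.exp_add, ← Real.exp_add]
        ring_nf
        simp
      have e1' := congrArg (fun y : ℝ => (y : ℂ)) e1
      have e2' := congrArg (fun y : ℝ => (y : ℂ)) e2
      simp only [Complex.ofReal_mul, Complex.ofReal_div, Complex.ofReal_add, Complex.ofReal_sub,
        Complex.ofReal_one, Complex.ofReal_ofNat] at e1' e2'
      simp only [hP, hQ, hη, ← ha]
      simp only [Complex.ofReal_mul]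
      linear_combination (-(a:ℂ) * A ξ * θ ξ) * e1' - G ξ * θ ξ * e2'
    rw [hrw]
    have hle := norm_integral_smul_fourier_le (k := fun _ => 1) (B := 1) (hf2 T hT) (hM T hT)
      (by simp) m1 c1 (inv_pos.2 hT)
    simp only [one_mul] at hle
    refine hle.trans ?_
    have hsq : ∫ ξ : EuclideanSpace ℝ (Fin n), ‖((2 * Real.pi * ‖ξ‖ : ℝ) : ℂ) * η ξ‖ ^ 2 ≤
        ∫ ξ, T⁻¹ ^ 2 * ‖θ ξ‖ ^ 2 := by
      have q1 : HasCompactSupport fun ξ => ‖((2 * Real.pi * ‖ξ‖ : ℝ) : ℂ) * η ξ‖ ^ 2 :=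
        HasCompactSupport.intro hηc fun ξ hξ => by simp [image_eq_zero_of_notMem_tsupport hξ]
      have q2 : HasCompactSupport fun ξ => ‖θ ξ‖ ^ 2 :=
        HasCompactSupport.intro hc fun ξ hξ => by simp [image_eq_zero_of_notMem_tsupport hξ]
      refine integral_mono ((m1.continuous.norm.pow 2).integrable_of_hasCompactSupport q1)
        (((hθ.continuous.norm.pow 2).integrable_of_hasCompactSupport q2).const_mul _) fun ξ => ?_
      have ha : 0 ≤ 2 * Real.pi * ‖ξ‖ := by positivity
      simp only [hη]
      rw [norm_mul, norm_mul, Complex.norm_real, Complex.norm_real, Real.norm_eq_abs,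
        Real.norm_eq_abs, Real.abs_exp, abs_of_nonneg ha]
      rw [← mul_assoc, mul_pow]
      refine mul_le_mul_of_nonneg_right ?_ (sq_nonneg _)
      refine pow_le_pow_left₀ (by positivity) ?_ 2
      rw [Real.exp_neg, ← div_eq_mul_inv, inv_eq_one_div,
        div_le_div_iff₀ (Real.exp_pos _) hT]
      linarith [Real.add_one_le_exp (2 * Real.pi * ‖ξ‖ * T)]
    rw [integral_const_mul] at hsq
    have : (∫ ξ : EuclideanSpace ℝ (Fin n), ‖((2 * Real.pi * ‖ξ‖ : ℝ) : ℂ) * η ξ‖ ^ 2) / T⁻¹ ≤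
        T⁻¹ * ∫ ξ, ‖θ ξ‖ ^ 2 := by
      rw [div_le_iff₀ (inv_pos.2 hT)]
      exact hsq.trans_eq (by ring)
    linarith
  have l1 := ((tendsto_integral_exp_mul hQi (by
    simp [hQ, image_eq_zero_of_notMem_tsupport h0])).const_add (∫ ξ, P ξ)).const_mul (1 / 2 : ℂ)
  have l2 : Tendsto (fun T : ℝ => ((M + ∫ ξ, ‖θ ξ‖ ^ 2) / 2) * T⁻¹) atTop (𝓝 0) := by
    simpa using tendsto_inv_atTop_zero.const_mul ((M + ∫ ξ, ‖θ ξ‖ ^ 2) / 2)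
  have l3 := le_of_tendsto_of_tendsto l1.norm l2 (by
    filter_upwards [eventually_gt_atTop (0:ℝ)] with T hT using hbound T hT)
  simpa using norm_le_zero_iff.1 l3

lemma fourier_relation {u : EuclideanSpace ℝ (Fin (n+1)) → ℝ}
    (hu1 : ContDiffOn ℝ 1 u (closedHalf n)) (hu : HarmonicOnSet u (openHalf n))
    (hf2 : ∀ t, 0 < t → Integrable fun x => slice u t x ^ 2) {M : ℝ}
    (hM : ∀ t, 0 < t → ∫ x, slice u t x ^ 2 ≤ M)
    (h02 : Integrable fun x => slice u 0 x ^ 2) (hg2 : Integrable fun x => dt u 0 x ^ 2)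
    (h01 : Integrable (slice u 0)) (hg1 : Integrable (dt u 0))
    {ξ : EuclideanSpace ℝ (Fin n)} (hξ : ξ ≠ 0) :
    (2 * Real.pi * ‖ξ‖ : ℝ) * 𝓕 (fun x => (slice u 0 x : ℂ)) ξ
      + 𝓕 (fun x => (dt u 0 x : ℂ)) ξ = 0 := by
  set A := 𝓕 (fun x => (slice u 0 x : ℂ)) with hA
  set G := 𝓕 (fun x => (dt u 0 x : ℂ)) with hG
  have hAc : Continuous A := continuous_fourier_of_integrable h01.ofReal
  have hGc : Continuous G := continuous_fourier_of_integrable hg1.ofReal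
  have hFc : Continuous fun ξ => ((2 * Real.pi * ‖ξ‖ : ℝ) : ℂ) * A ξ + G ξ :=
    ((by fun_prop : Continuous fun ξ : EuclideanSpace ℝ (Fin n) =>
      ((2 * Real.pi * ‖ξ‖ : ℝ) : ℂ)).mul hAc).add hGc
  have h1 := (isOpen_compl_singleton (x := (0 : EuclideanSpace ℝ (Fin n)))
    ).ae_eq_zero_of_integral_contDiff_smul_eq_zero (μ := volume)
    (hFc.locallyIntegrable.locallyIntegrableOn _) fun g hg hgc hgs => by
      have h2 := integral_mul_fourier_relation hu1 hu hf2 hM h02 hg2 h01 hg1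
        (θ := fun x => (g x : ℂ)) (Complex.ofRealCLM.contDiff.comp hg)
        (hgc.comp_left Complex.ofReal_zero)
        (fun h => by
          have : (0 : EuclideanSpace ℝ (Fin n)) ∈ tsupport g :=
            tsupport_comp_subset (g := fun y : ℝ => (y : ℂ)) Complex.ofReal_zero g h
          exact hgs this rfl)
      simpa only [Complex.real_smul] using h2
  have h3 : (fun ξ => (‖ξ‖ : ℂ) * (((2 * Real.pi * ‖ξ‖ : ℝ) : ℂ) * A ξ + G ξ)) =ᵐ[volume]
      fun _ => 0 := by
    filter_upwards [h1] with y hy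
    rcases eq_or_ne y 0 with rfl | hy0
    · simp
    · rw [hy hy0, mul_zero]
  have h4 := (Continuous.ae_eq_iff_eq volume ((by fun_prop : Continuous
    fun ξ : EuclideanSpace ℝ (Fin n) => (‖ξ‖ : ℂ)).mul hFc) continuous_const).1 h3
  exact (mul_eq_zero.1 (congrFun h4 ξ)).resolve_left (by simpa using hξ)

/-- The Fourier transform of an exponentially decaying function is real analytic along lines. -/
lemma analyticAt_fourier_line {f : EuclideanSpace ℝ (Fin n) → ℂ} {c : ℝ} (hc : 0 < c)
    (hf : Integrable f) (hfe : Integrable fun x => Real.exp (c * ‖x‖) * ‖f x‖)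
    {v : EuclideanSpace ℝ (Fin n)} (hv : ‖v‖ = 1) (s : ℝ) :
    AnalyticAt ℝ (fun s : ℝ => 𝓕 f (s • v)) s := by
  set q : EuclideanSpace ℝ (Fin n) → ℝ := fun x => 2 * Real.pi * inner ℝ x v with hq
  have hqc : Continuous q := by fun_prop
  have hqn : ∀ x, |q x| ≤ 2 * Real.pi * ‖x‖ := fun x => by
    have h := abs_real_inner_le_norm x v
    rw [hv, mul_one] at h
    rw [hq, abs_mul, abs_of_pos Real.two_pi_pos]
    exact mul_le_mul_of_nonneg_left h Real.two_pi_pos.le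
  set F : ℂ → ℂ := fun z => ∫ x, Complex.exp (-(q x * Complex.I) * z) * f x with hF
  have hFs : (fun s : ℝ => 𝓕 f (s • v)) = fun s : ℝ => F s := by
    funext s
    rw [Real.fourier_eq', hF]
    refine integral_congr_ae (Eventually.of_forall fun x => ?_)
    simp only [smul_eq_mul, inner_smul_right, hq]
    congr 2
    push_cast
    ring
  have hcont : ∀ z : ℂ, Continuous fun x => Complex.exp (-(q x * Complex.I) * z) := fun z =>
    Complex.continuous_exp.comp (by fun_prop)
  set S : Set ℂ := {z | |z.im| < c / (4 * Real.pi)} with hS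
  have hSo : IsOpen S := isOpen_lt (by fun_prop) continuous_const
  have hnorm : ∀ z ∈ S, ∀ x, ‖Complex.exp (-(q x * Complex.I) * z)‖ ≤
      Real.exp (c / 2 * ‖x‖) := fun z hz x => by
    rw [Complex.norm_exp]
    refine Real.exp_le_exp.2 ?_
    have : (-(q x * Complex.I) * z).re = q x * z.im := by simp
    rw [this]
    calc q x * z.im ≤ |q x| * |z.im| := by rw [← abs_mul]; exact le_abs_self _
      _ ≤ (2 * Real.pi * ‖x‖) * (c / (4 * Real.pi)) :=
        mul_le_mul (hqn x) (le_of_lt hz) (abs_nonneg _) (by positivity)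
      _ = c / 2 * ‖x‖ := by field_simp; ring
  have hD : DifferentiableOn ℂ F S := fun z hz => by
    have h := hasDerivAt_integral_of_dominated_loc_of_deriv_le (μ := volume) (x₀ := z) (s := S)
      (F := fun z x => Complex.exp (-(q x * Complex.I) * z) * f x)
      (F' := fun z x => Complex.exp (-(q x * Complex.I) * z) * (-(q x * Complex.I)) * f x)
      (bound := fun x => 4 * Real.pi / c * (Real.exp (c * ‖x‖) * ‖f x‖))
      (hSo.mem_nhds hz)
      (Eventually.of_forall fun z => (hcont z).aestronglyMeasurable.mul hf.1)
      ?_ ?_ ?_ (hfe.const_mul _) ?_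
    · exact h.2.differentiableAt.differentiableWithinAt
    · refine hfe.mono' ((hcont z).aestronglyMeasurable.mul hf.1) (Eventually.of_forall fun x => ?_)
      rw [norm_mul]
      refine mul_le_mul_of_nonneg_right ((hnorm z hz x).trans (Real.exp_le_exp.2 ?_))
        (norm_nonneg _)
      have := mul_nonneg hc.le (norm_nonneg x)
      linarith
    · exact ((hcont z).mul (by fun_prop)).aestronglyMeasurable.mul hf.1
    · refine Eventually.of_forall fun x y hy => ?_
      rw [norm_mul, norm_mul, ← mul_assoc]
      refine mul_le_mul_of_nonneg_right ?_ (norm_nonneg _)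
      have h1 : ‖-(q x * Complex.I : ℂ)‖ ≤ 4 * Real.pi / c * (c / 2 * ‖x‖) := by
        rw [norm_neg, norm_mul, Complex.norm_I, mul_one, Complex.norm_real, Real.norm_eq_abs]
        refine (hqn x).trans_eq ?_
        field_simp
        ring
      have h2 : c / 2 * ‖x‖ ≤ Real.exp (c / 2 * ‖x‖) := by
        linarith [Real.add_one_le_exp (c / 2 * ‖x‖)]
      calc _ ≤ Real.exp (c / 2 * ‖x‖) * (4 * Real.pi / c * (c / 2 * ‖x‖)) :=
            mul_le_mul (hnorm y hy x) h1 (norm_nonneg _) (Real.exp_nonneg _)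
        _ ≤ Real.exp (c / 2 * ‖x‖) * (4 * Real.pi / c * Real.exp (c / 2 * ‖x‖)) := by gcongr
        _ = 4 * Real.pi / c * Real.exp (c * ‖x‖) := by
          have : Real.exp (c * ‖x‖) = Real.exp (c / 2 * ‖x‖) * Real.exp (c / 2 * ‖x‖) := by
            rw [← Real.exp_add]; ring_nf
          rw [this]; ring
    · refine Eventually.of_forall fun x y _ => HasDerivAt.mul_const ?_ _
      simpa using ((hasDerivAt_id y).const_mul (-(q x * Complex.I : ℂ))).cexp
  rw [hFs]
  have hs : (s : ℂ) ∈ S := by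
    simp only [hS, mem_ofPred_eq, Complex.ofReal_im, abs_zero]
    positivity
  exact ((hD.analyticAt (hSo.mem_nhds hs)).restrictScalars (𝕜 := ℝ)).comp
    (Complex.ofRealCLM.analyticAt s)

lemma fourier_eq_zero_of_relation {f g : EuclideanSpace ℝ (Fin n) → ℂ} {c : ℝ} (hc : 0 < c)
    (hf : Integrable f) (hfe : Integrable fun x => Real.exp (c * ‖x‖) * ‖f x‖)
    (hg : Integrable g) (hge : Integrable fun x => Real.exp (c * ‖x‖) * ‖g x‖)
    (hrel : ∀ ξ ≠ 0, (2 * Real.pi * ‖ξ‖ : ℝ) * 𝓕 f ξ + 𝓕 g ξ = 0)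
    {ξ : EuclideanSpace ℝ (Fin n)} (hξ : ξ ≠ 0) : 𝓕 f ξ = 0 ∧ 𝓕 g ξ = 0 := by
  have hpos : 0 < ‖ξ‖ := norm_pos_iff.2 hξ
  set v : EuclideanSpace ℝ (Fin n) := (-‖ξ‖⁻¹) • ξ with hv
  have hv1 : ‖v‖ = 1 := by
    rw [hv, norm_smul, norm_neg, norm_inv, norm_norm, inv_mul_cancel₀ hpos.ne']
  have hvξ : (-‖ξ‖) • v = ξ := by
    rw [hv, smul_smul, neg_mul_neg, mul_inv_cancel₀ hpos.ne', one_smul]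
  have hK : AnalyticOnNhd ℝ (fun s : ℝ => (2 * Real.pi * s : ℝ) * 𝓕 f (s • v) + 𝓕 g (s • v))
      univ := fun s _ => by
    refine AnalyticAt.add (AnalyticAt.mul ?_ (analyticAt_fourier_line hc hf hfe hv1 s))
      (analyticAt_fourier_line hc hg hge hv1 s)
    exact (Complex.ofRealCLM.analyticAt _).comp (analyticAt_const.mul analyticAt_id)
  have hz := hK.eqOn_zero_of_preconnected_of_eventuallyEq_zero isPreconnected_univ
    (mem_univ 1) (by
      filter_upwards [eventually_gt_nhds (zero_lt_one : (0:ℝ) < 1)] with s hs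
      have hne : s • v ≠ 0 := by
        rw [← norm_pos_iff, norm_smul, hv1, mul_one]
        exact norm_pos_iff.2 hs.ne'
      have h := hrel _ hne
      rwa [norm_smul, hv1, mul_one, Real.norm_eq_abs, abs_of_pos hs] at h) (mem_univ (-‖ξ‖))
  simp only [hvξ, Pi.zero_apply, mul_neg, Complex.ofReal_neg, neg_mul] at hz
  have h := hrel ξ hξ
  have hg0 : 𝓕 g ξ = 0 := by linear_combination (h + hz) / 2
  refine ⟨?_, hg0⟩
  rw [hg0, add_zero] at h
  exact (mul_eq_zero.1 h).resolve_left (by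
    exact_mod_cast (mul_pos Real.two_pi_pos hpos).ne')

/-- A square integrable function whose Fourier transform vanishes away from the origin is zero. -/
lemma ae_eq_zero_of_integral_smul_fourier [NeZero n] {f : EuclideanSpace ℝ (Fin n) → ℝ}
    (hf : Continuous f) (hf2 : Integrable fun x => f x ^ 2)
    (h : ∀ η : EuclideanSpace ℝ (Fin n) → ℂ, ContDiff ℝ ∞ η → HasCompactSupport η →
      0 ∉ tsupport η → ∫ x, f x • 𝓕 η x = 0) : f =ᵐ[volume] 0 := by
  have hm : MemLp (fun x => (f x : ℂ)) 2 :=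
    ((memLp_two_iff_integrable_sq hf.aestronglyMeasurable).2 hf2).ofReal
  set L := hm.toLp with hL
  set G := 𝓕⁻ L with hG
  have hGL : 𝓕 G = L := (Lp.fourierTransformₗᵢ _ ℂ).apply_symm_apply L
  have hGl : LocallyIntegrable G := (Lp.memLp G).locallyIntegrable (by norm_num)
  have hGc : LocallyIntegrable fun ξ => (starRingEnd ℂ) (G ξ) := by
    refine (locallyIntegrable_iff).2 fun K hK => ?_
    have := (locallyIntegrable_iff.1 hGl K hK)
    exact (integrable_norm_iff (Complex.continuous_conj.comp_aestronglyMeasurable this.1)).1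
      (by simpa using this.norm)
  have h1 := (isOpen_compl_singleton (x := (0 : EuclideanSpace ℝ (Fin n)))
    ).ae_eq_zero_of_integral_contDiff_smul_eq_zero (μ := volume)
    (hGc.locallyIntegrableOn _) fun g hg hgc hgs => by
      have k1 : ContDiff ℝ ∞ fun x => (g x : ℂ) := Complex.ofRealCLM.contDiff.comp hg
      have k2 : HasCompactSupport fun x => (g x : ℂ) := hgc.comp_left Complex.ofReal_zero
      have h2 := h (fun x => (g x : ℂ)) k1 k2
        (fun h => by
          have : (0 : EuclideanSpace ℝ (Fin n)) ∈ tsupport g :=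
            tsupport_comp_subset (g := fun y : ℝ => (y : ℂ)) Complex.ofReal_zero g h
          exact hgs this rfl)
      set m := k2.toSchwartzMap k1 with hm'
      have h3 : inner ℂ L (𝓕 (m.toLp 2)) = 0 := by
        rw [SchwartzMap.toLp_fourier_eq, L2.inner_def, ← h2]
        refine integral_congr_ae ?_
        filter_upwards [hm.coeFn_toLp, (𝓕 m).coeFn_toLp 2 volume] with x hx hx'
        rw [hx', hL, hx, SchwartzMap.fourier_coe]
        simp only [RCLike.inner_apply, Complex.conj_ofReal, Complex.real_smul]
        exact mul_comm _ _
      rw [← hGL, Lp.inner_fourier_eq, L2.inner_def] at h3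
      rw [← h3]
      refine integral_congr_ae ?_
      filter_upwards [m.coeFn_toLp 2 volume] with x hx
      rw [hx]
      simp [hm']
  have hG0 : G = 0 := by
    rw [Lp.eq_zero_iff_ae_eq_zero]
    filter_upwards [h1, (compl_mem_ae_iff (s := {(0 : EuclideanSpace ℝ (Fin n))})).2
      (measure_singleton _)] with x hx hx0
    simpa using hx hx0
  have hL0 : L = 0 := by
    rw [← hGL, hG0]
    exact (Lp.fourierTransformₗᵢ _ ℂ).map_zero
  filter_upwards [hm.coeFn_toLp, (Lp.eq_zero_iff_ae_eq_zero).1 hL0] with x hx hx'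
  have := hx.symm.trans hx'
  simpa using this

/-- Exponentially decaying Cauchy data force an `L²`-bounded harmonic function to vanish. -/
lemma slice_eq_zero [NeZero n] {u : EuclideanSpace ℝ (Fin (n+1)) → ℝ}
    (hu1 : ContDiffOn ℝ 1 u (closedHalf n)) (hu : HarmonicOnSet u (openHalf n))
    (hf2 : ∀ t, 0 < t → Integrable fun x => slice u t x ^ 2) {M : ℝ}
    (hM : ∀ t, 0 < t → ∫ x, slice u t x ^ 2 ≤ M)
    (h02 : Integrable fun x => slice u 0 x ^ 2) (hg2 : Integrable fun x => dt u 0 x ^ 2)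
    (h01 : Integrable (slice u 0)) (hg1 : Integrable (dt u 0)) {c : ℝ} (hc : 0 < c)
    (h0e : Integrable fun x => Real.exp (c * ‖x‖) * ‖slice u 0 x‖)
    (hge : Integrable fun x => Real.exp (c * ‖x‖) * ‖dt u 0 x‖) {T : ℝ} (hT : 0 < T)
    (x : EuclideanSpace ℝ (Fin n)) : slice u T x = 0 := by
  have hF : ∀ ξ : EuclideanSpace ℝ (Fin n), ξ ≠ 0 →
      𝓕 (fun x => (slice u 0 x : ℂ)) ξ = 0 ∧ 𝓕 (fun x => (dt u 0 x : ℂ)) ξ = 0 := fun ξ hξ =>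
    fourier_eq_zero_of_relation (f := fun x => (slice u 0 x : ℂ)) (g := fun x => (dt u 0 x : ℂ))
      hc h01.ofReal (by simpa only [Complex.norm_real] using h0e) hg1.ofReal
      (by simpa only [Complex.norm_real] using hge)
      (fun ξ hξ => fourier_relation hu1 hu hf2 hM h02 hg2 h01 hg1 hξ) hξ
  have hcont : Continuous (slice u T) := (continuous_slice hu1).comp (by fun_prop : Continuous
    fun x : EuclideanSpace ℝ (Fin n) => (T, x))
  have hae := ae_eq_zero_of_integral_smul_fourier hcont (hf2 T hT) fun η hη hηc h0 => by
    set θ : EuclideanSpace ℝ (Fin n) → ℂ := fun ξ => (((2 * Real.pi * ‖ξ‖)⁻¹ : ℝ) : ℂ) * η ξ with hθ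
    have hθs : ContDiff ℝ ∞ θ := by
      refine contDiff_radial_mul (h := fun a => ((a⁻¹ : ℝ) : ℂ)) ?_ hη h0
      exact Complex.ofRealCLM.contDiff.comp_contDiffOn
        (contDiffOn_id.inv fun a ha => (mem_Ioi.1 ha).ne')
    have hθc : HasCompactSupport θ := hηc.mul_left
    have hθ0 : 0 ∉ tsupport θ := fun h => h0 (tsupport_mul_subset_right h)
    have hηθ : (fun ξ => ((2 * Real.pi * ‖ξ‖ : ℝ) : ℂ) * θ ξ) = η := by
      funext ξ
      rcases eq_or_ne ξ 0 with rfl | hξ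
      · simp [image_eq_zero_of_notMem_tsupport h0]
      · have : (2 * Real.pi * ‖ξ‖) ≠ 0 := by
          have := norm_pos_iff.2 hξ
          positivity
        rw [hθ, ← mul_assoc, ← Complex.ofReal_mul, mul_inv_cancel₀ this, Complex.ofReal_one,
          one_mul]
    have hid := slab_identity hu1 hu hf2 hM h02 hg2 hθs hθc hθ0 hT
    have i2 : Integrable fun ξ =>
        ((2 * Real.pi * ‖ξ‖ * Real.cosh (2 * Real.pi * ‖ξ‖ * T) : ℝ) : ℂ) * θ ξ :=
      Continuous.integrable_of_hasCompactSupport ((Complex.continuous_ofReal.comp (Continuous.mul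
        (by fun_prop) (Real.continuous_cosh.comp (by fun_prop)))).mul hθs.continuous) hθc.mul_left
    have i3 : Integrable fun ξ => (Real.sinh (2 * Real.pi * ‖ξ‖ * T) : ℂ) * θ ξ :=
      Continuous.integrable_of_hasCompactSupport ((Complex.continuous_ofReal.comp
        (Real.continuous_sinh.comp (by fun_prop))).mul hθs.continuous) hθc.mul_left
    have hθz : θ 0 = 0 := image_eq_zero_of_notMem_tsupport hθ0
    rw [hηθ, integral_smul_fourier h01 i2, integral_smul_fourier hg1 i3] at hid
    rw [hid, integral_eq_zero_of_ae, integral_eq_zero_of_ae, add_zero]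
    all_goals
      refine Eventually.of_forall fun ξ => ?_
      rcases eq_or_ne ξ 0 with rfl | hξ
      · simp [hθz]
      · simp [hF ξ hξ]
  exact congrFun ((hcont.ae_eq_iff_eq volume continuous_zero).1 hae) x

lemma integrable_exp_neg_mul_norm {a : ℝ} (ha : 0 < a) :
    Integrable fun x : EuclideanSpace ℝ (Fin n) => Real.exp (-a * ‖x‖) := by
  have h := integrable_one_add_norm (E := EuclideanSpace ℝ (Fin n)) (μ := volume)
    (r := ((n + 1 : ℕ) : ℝ)) (by simp)
  refine (h.const_mul (Real.exp a * (n + 1).factorial / a ^ (n + 1))).mono'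
    (Continuous.aestronglyMeasurable (by fun_prop)) (Eventually.of_forall fun x => ?_)
  rw [Real.norm_eq_abs, Real.abs_exp, Real.rpow_neg (by positivity), Real.rpow_natCast]
  have h1 := Real.pow_div_factorial_le_exp (a * (1 + ‖x‖)) (by positivity) (n + 1)
  have h2 : Real.exp (-a * ‖x‖) * Real.exp (a * (1 + ‖x‖)) = Real.exp a := by
    rw [← Real.exp_add]; ring_nf
  rw [← div_eq_mul_inv, div_div, le_div_iff₀ (by positivity), ← h2, mul_assoc, ← mul_pow]
  refine mul_le_mul_of_nonneg_left ?_ (Real.exp_nonneg _)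
  rwa [div_le_iff₀ (by positivity)] at h1

lemma integrable_of_exp_weight {f : EuclideanSpace ℝ (Fin n) → ℝ} (hf : Continuous f) {c : ℝ}
    (hc : 0 < c) (h : Integrable fun x => Real.exp (c * ‖x‖) * ‖f x‖) : Integrable f :=
  h.mono' hf.aestronglyMeasurable (Eventually.of_forall fun _ =>
    le_mul_of_one_le_left (norm_nonneg _) (Real.one_le_exp (by positivity)))

lemma integrable_exp_mul_norm_of_sq {f : EuclideanSpace ℝ (Fin n) → ℝ} (hf : Continuous f) {a : ℝ}
    (ha : 0 < a) (h : Integrable fun x => Real.exp (a * ‖x‖) * f x ^ 2) :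
    Integrable fun x => Real.exp (a / 4 * ‖x‖) * ‖f x‖ := by
  refine (h.add (integrable_exp_neg_mul_norm (half_pos ha))).mono'
    (Continuous.aestronglyMeasurable (by fun_prop)) (Eventually.of_forall fun x => ?_)
  rw [Real.norm_of_nonneg (by positivity), Real.norm_eq_abs, Pi.add_apply, ← sq_abs (f x)]
  have e1 : Real.exp (a * ‖x‖) = Real.exp (a / 2 * ‖x‖) ^ 2 := by
    rw [← Real.exp_nat_mul]; ring_nf
  have e2 : Real.exp (-(a / 2) * ‖x‖) = Real.exp (-(a / 4) * ‖x‖) ^ 2 := by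
    rw [← Real.exp_nat_mul]; ring_nf
  have e3 : Real.exp (a / 4 * ‖x‖) = Real.exp (a / 2 * ‖x‖) * Real.exp (-(a / 4) * ‖x‖) := by
    rw [← Real.exp_add]; ring_nf
  rw [e1, e2, e3]
  nlinarith [sq_nonneg (Real.exp (a / 2 * ‖x‖) * |f x| - Real.exp (-(a / 4) * ‖x‖)),
    sq_nonneg (Real.exp (a / 2 * ‖x‖) * |f x|), sq_nonneg (Real.exp (-(a / 4) * ‖x‖))]

end HalfSpace

/-- Boundary decay implies bulk decay: if `ũ` is harmonic on the upper half-space with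
`u = ũ(·, 0)` and `g = ∂_{n+1}ũ(·, 0)` satisfying (i) `|u(x')| ≤ Λ e^{−λ|x'|}`,
(ii) `‖ũ(·, t)‖_{L²(ℝⁿ)} ≤ Λ` for all `t > 0`, and
(iii) `∫ e^{λ|x'|/2}(|g|² + |g|ᵖ) dx' ≤ Λ`, then `|ũ(x)| ≤ C e^{−c|x|}` on `ℝ^{n+1}_+`,
where `C, c > 0` depend only on `n, p, λ, Λ`. -/
theorem boundary_decay_to_bulk_decay (n : ℕ) (hn : 1 ≤ n) (p lam Lam : ℝ)
    (hp : (n : ℝ) < p) (hlam : 0 < lam) (hLam : 0 < Lam) :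
    ∃ C > (0 : ℝ), ∃ c > (0 : ℝ),
      ∀ u : EuclideanSpace ℝ (Fin (n+1)) → ℝ,
        ContDiffOn ℝ 1 u {x | 0 ≤ x (Fin.last n)} →
        HarmonicOnSet u {x | 0 < x (Fin.last n)} →
        (∀ x' : EuclideanSpace ℝ (Fin n), |u (emb x')| ≤ Lam * Real.exp (-lam * ‖x'‖)) →
        (∀ t : ℝ, 0 < t →
          ∫⁻ x' : EuclideanSpace ℝ (Fin n), ENNReal.ofReal ((u (embt x' t)) ^ 2) ≤
            ENNReal.ofReal (Lam ^ 2)) →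
        (∫⁻ x' : EuclideanSpace ℝ (Fin n), ENNReal.ofReal (Real.exp (lam * ‖x'‖ / 2) *
            (|fderivWithin ℝ u {y | 0 ≤ y (Fin.last n)} (emb x')
                (EuclideanSpace.single (Fin.last n) 1)| ^ 2 +
             |fderivWithin ℝ u {y | 0 ≤ y (Fin.last n)} (emb x')
                (EuclideanSpace.single (Fin.last n) 1)| ^ p)) ≤ ENNReal.ofReal Lam) →
        ∀ x : EuclideanSpace ℝ (Fin (n+1)), 0 < x (Fin.last n) →
          |u x| ≤ C * Real.exp (-c * ‖x‖) := by
  refine ⟨1, one_pos, 1, one_pos, fun u hu1 hu hu0 hL2 hg x hx => ?_⟩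
  have : NeZero n := ⟨(Nat.one_le_iff_ne_zero.1 hn)⟩
  have hsc : ∀ t : ℝ, Continuous (slice u t) := fun t => (continuous_slice hu1).comp
    (by fun_prop : Continuous fun x : EuclideanSpace ℝ (Fin n) => (t, x))
  have hgc : Continuous (dt u 0) := (continuous_dt hu1).comp
    (by fun_prop : Continuous fun x : EuclideanSpace ℝ (Fin n) => ((0:ℝ), x))
  have hs0 : ∀ y, |slice u 0 y| ≤ Lam * Real.exp (-lam * ‖y‖) := fun y => by
    have h := hu0 y
    simpa [slice, embt, emb] using h
  have hf2 : ∀ t, 0 < t → Integrable fun y => slice u t y ^ 2 := fun t ht => by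
    refine ⟨((hsc t).pow 2).aestronglyMeasurable, ?_⟩
    rw [hasFiniteIntegral_iff_ofReal (Filter.Eventually.of_forall fun y => sq_nonneg _)]
    simp only [slice_eq ht]
    exact (hL2 t ht).trans_lt ENNReal.ofReal_lt_top
  have hM : ∀ t, 0 < t → ∫ y, slice u t y ^ 2 ≤ Lam ^ 2 := fun t ht => by
    rw [integral_eq_lintegral_of_nonneg_ae (Filter.Eventually.of_forall fun y => sq_nonneg _)
      ((hsc t).pow 2).aestronglyMeasurable]
    refine ENNReal.toReal_le_of_le_ofReal (sq_nonneg _) ?_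
    simp only [slice_eq ht]
    exact hL2 t ht
  have hge2 : Integrable fun y => Real.exp (lam / 2 * ‖y‖) * dt u 0 y ^ 2 := by
    refine ⟨Continuous.aestronglyMeasurable (by fun_prop), ?_⟩
    rw [hasFiniteIntegral_iff_ofReal (Filter.Eventually.of_forall fun y => by positivity)]
    refine lt_of_le_of_lt (lintegral_mono fun y => ENNReal.ofReal_le_ofReal ?_)
      (hg.trans_lt ENNReal.ofReal_lt_top)
    have he : dt u 0 y = fderivWithin ℝ u {y | 0 ≤ y (Fin.last n)} (emb y)
        (EuclideanSpace.single (Fin.last n) 1) := by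
      simp [dt, embt, emb, closedHalf]
    rw [he, ← sq_abs, div_mul_eq_mul_div]
    exact mul_le_mul_of_nonneg_left (le_add_of_nonneg_right (by positivity)) (Real.exp_nonneg _)
  have h0e2 : Integrable fun y => Real.exp (lam / 2 * ‖y‖) * slice u 0 y ^ 2 := by
    refine ((integrable_exp_neg_mul_norm hlam).const_mul (Lam ^ 2)).mono'
      (Continuous.aestronglyMeasurable (by have := hsc 0; fun_prop))
      (Filter.Eventually.of_forall fun y => ?_)
    rw [Real.norm_of_nonneg (by positivity), ← sq_abs (slice u 0 y)]
    calc _ ≤ Real.exp (lam / 2 * ‖y‖) * (Lam * Real.exp (-lam * ‖y‖)) ^ 2 := by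
          gcongr; exact hs0 y
      _ = Lam ^ 2 * Real.exp (lam / 2 * ‖y‖ + 2 * (-lam * ‖y‖)) := by
          rw [Real.exp_add, two_mul, Real.exp_add]; ring
      _ ≤ Lam ^ 2 * Real.exp (-lam * ‖y‖) := by
          have := mul_nonneg hlam.le (norm_nonneg y)
          gcongr; linarith
  have hsq : ∀ f : EuclideanSpace ℝ (Fin n) → ℝ, Continuous f →
      Integrable (fun y => Real.exp (lam / 2 * ‖y‖) * f y ^ 2) → Integrable fun y => f y ^ 2 :=
    fun f hf h => integrable_of_exp_weight (hf.pow 2) (half_pos hlam) (by simpa using h)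
  have hc : 0 < lam / 2 / 4 := by positivity
  have h0e := integrable_exp_mul_norm_of_sq (hsc 0) (half_pos hlam) h0e2
  have hge := integrable_exp_mul_norm_of_sq hgc (half_pos hlam) hge2
  obtain ⟨x', hx'⟩ := exists_embt_eq x
  have hz := slice_eq_zero hu1 hu hf2 hM (hsq _ (hsc 0) h0e2) (hsq _ hgc hge2)
    (integrable_of_exp_weight (hsc 0) hc h0e) (integrable_of_exp_weight hgc hc hge) hc h0e hge hx x'
  rw [slice_eq hx, hx'] at hz
  rw [hz, abs_zero]
  positivity
end
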